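/- arXiv:math/0608799 — 7 statements merged into one kernel-verified Lean document; each statement's English description precedes it below -/
import Mathlib

section
/- For all natural numbers u and v, h(u+v) ≥ h(u) + h(v). -/
/-- `binOnes n` is the number of 1s in the binary expansion of `n`. -/
def binOnes (n : ℕ) : ℕ := (Nat.digits 2 n).count 1

/-- `h n = ⌈n/2⌉ - b n`, regarded as an integer. -/
def hFun (n : ℕ) : ℤ := (((n + 1) / 2 : ℕ) : ℤ) - (binOnes n : ℤ)

theorem binOnes_eq_mod_add_div (n : ℕ) : binOnes n = n % 2 + binOnes (n / 2) := by
  rcases Nat.eq_zero_or_pos n with rfl | hn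
  · simp [binOnes]
  · unfold binOnes
    rw [Nat.digits_def' one_lt_two hn, List.count_cons]
    rcases Nat.mod_two_eq_zero_or_one n with h | h <;> simp [h, add_comm]

theorem binOnes_succ_le (n : ℕ) : binOnes (n + 1) ≤ binOnes n + 1 := by
  induction n using Nat.strong_induction_on with
  | _ n ih =>
    have h₁ := binOnes_eq_mod_add_div (n + 1)
    have h₂ := binOnes_eq_mod_add_div n
    rcases Nat.mod_two_eq_zero_or_one n with h | h
    · rw [show (n + 1) / 2 = n / 2 by omega] at h₁
      omega
    · rw [show (n + 1) / 2 = n / 2 + 1 by omega] at h₁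
      have := ih (n / 2) (by omega)
      omega

theorem binOnes_add_le (u v : ℕ) : binOnes (u + v) ≤ binOnes u + binOnes v := by
  induction u using Nat.strong_induction_on generalizing v with
  | _ u ih =>
    rcases Nat.eq_zero_or_pos u with rfl | hu
    · simp
    · have h := binOnes_eq_mod_add_div (u + v)
      have h₁ := binOnes_eq_mod_add_div u
      have h₂ := binOnes_eq_mod_add_div v
      have h₃ := ih (u / 2) (by omega) (v / 2)
      by_cases hc : u % 2 = 1 ∧ v % 2 = 1
      · rw [show (u + v) / 2 = u / 2 + v / 2 + 1 by omega] at h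
        have := binOnes_succ_le (u / 2 + v / 2)
        omega
      · rw [show (u + v) / 2 = u / 2 + v / 2 by omega] at h
        omega

theorem hFun_add_ge (u v : ℕ) : hFun u + hFun v ≤ hFun (u + v) := by
  unfold hFun
  have h := binOnes_add_le u v
  by_cases hc : u % 2 = 1 ∧ v % 2 = 1
  · have h₀ := binOnes_eq_mod_add_div (u + v)
    have h₁ := binOnes_eq_mod_add_div u
    have h₂ := binOnes_eq_mod_add_div v
    rw [show (u + v) / 2 = u / 2 + v / 2 + 1 by omega] at h₀
    have h₃ := binOnes_succ_le (u / 2 + v / 2)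
    have h₄ := binOnes_add_le (u / 2) (v / 2)
    omega
  · omega
end

section
/- For all natural numbers u ≥ 1 and v ≥ 2, h(uv) − u·h(v) ≥ ⌈(u−1)/2⌉. -/
theorem binOnes_zero : binOnes 0 = 0 := by simp [binOnes]

theorem binOnes_two_mul (n : ℕ) : binOnes (2 * n) = binOnes n := by
  rcases Nat.eq_zero_or_pos n with rfl | hn
  · rfl
  · have h := Nat.digits_add_two_add_one 0 (2 * n - 1)
    rw [show 2 * n - 1 + 1 = 2 * n by omega] at h
    simp [binOnes, h]

theorem binOnes_two_mul_add_one (n : ℕ) : binOnes (2 * n + 1) = binOnes n + 1 := by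
  simp [binOnes, show (2 * n + 1) / 2 = n by omega]

theorem binOnes_pos {n : ℕ} (hn : 0 < n) : 0 < binOnes n := by
  induction n using Nat.strong_induction_on with
  | _ n ih =>
    obtain ⟨k, rfl | rfl⟩ := Nat.even_or_odd' n
    · rw [binOnes_two_mul]
      exact ih k (by omega) (by omega)
    · rw [binOnes_two_mul_add_one]
      omega

theorem binOnes_le_half (n : ℕ) : binOnes n ≤ (n + 1) / 2 := by
  induction n using Nat.strong_induction_on with
  | _ n ih =>
    obtain ⟨k, rfl | rfl⟩ := Nat.even_or_odd' n
    · rcases Nat.eq_zero_or_pos k with rfl | hk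
      · simp [binOnes_zero]
      · have := ih k (by omega)
        rw [binOnes_two_mul]
        omega
    · rcases Nat.eq_zero_or_pos k with rfl | hk
      · simp [binOnes]
      · have := ih k (by omega)
        rw [binOnes_two_mul_add_one]
        omega

theorem binOnes_add_le_s4 (m n : ℕ) : binOnes (m + n) ≤ binOnes m + binOnes n := by
  induction hs : m + n using Nat.strong_induction_on generalizing m n with
  | _ s ih =>
    subst hs
    rcases Nat.eq_zero_or_pos m with rfl | hm
    · simp
    rcases Nat.eq_zero_or_pos n with rfl | hn
    · simp
    obtain ⟨k, rfl | rfl⟩ := Nat.even_or_odd' m <;> obtain ⟨l, rfl | rfl⟩ := Nat.even_or_odd' n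
    · have := ih (k + l) (by omega) k l rfl
      rwa [← mul_add, binOnes_two_mul, binOnes_two_mul, binOnes_two_mul]
    · have := ih (k + l) (by omega) k l rfl
      rw [show 2 * k + (2 * l + 1) = 2 * (k + l) + 1 by ring, binOnes_two_mul_add_one,
        binOnes_two_mul_add_one, binOnes_two_mul]
      omega
    · have := ih (k + l) (by omega) k l rfl
      rw [show 2 * k + 1 + 2 * l = 2 * (k + l) + 1 by ring, binOnes_two_mul_add_one,
        binOnes_two_mul_add_one, binOnes_two_mul]
      omega
    · have h₁ := ih (k + l) (by omega) k l rfl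
      have h₂ := ih (k + l + 1) (by omega) (k + l) 1 rfl
      have h₃ : binOnes 1 = 1 := by simp [binOnes]
      rw [show 2 * k + 1 + (2 * l + 1) = 2 * (k + l + 1) by ring, binOnes_two_mul,
        binOnes_two_mul_add_one, binOnes_two_mul_add_one]
      omega

theorem binOnes_mul_le (m n : ℕ) : binOnes (m * n) ≤ binOnes m * binOnes n := by
  induction m using Nat.strong_induction_on with
  | _ m ih =>
    obtain ⟨k, rfl | rfl⟩ := Nat.even_or_odd' m
    · rcases Nat.eq_zero_or_pos k with rfl | hk
      · simp [binOnes_zero]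
      · rw [mul_assoc, binOnes_two_mul, binOnes_two_mul]
        exact ih k (by omega)
    · have h₁ := binOnes_add_le_s4 (2 * (k * n)) n
      have h₂ := ih k (by omega)
      rw [binOnes_two_mul] at h₁
      rw [show (2 * k + 1) * n = 2 * (k * n) + n by ring, binOnes_two_mul_add_one, add_one_mul]
      omega

theorem hFun_mul (u v : ℕ) (hu : 1 ≤ u) (hv : 2 ≤ v) :
    ((((u - 1) + 1) / 2 : ℕ) : ℤ) ≤ hFun (u * v) - (u : ℤ) * hFun v := by
  have hmul := binOnes_mul_le u v
  have hhalf := binOnes_le_half u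
  have hbound := hmul.trans (Nat.mul_le_mul_right (binOnes v) hhalf)
  rw [Nat.sub_add_cancel hu]
  unfold hFun
  obtain ⟨l, rfl | rfl⟩ := Nat.even_or_odd' v
  · have hpos := binOnes_pos (n := 2 * l) (by omega)
    rw [show (u * (2 * l) + 1) / 2 = u * l by
      rw [show u * (2 * l) = 2 * (u * l) by ring]; omega, show (2 * l + 1) / 2 = l by omega]
    generalize binOnes (2 * l) = b at *
    generalize binOnes (u * (2 * l)) = c at *
    have hsplit : (u + 1) / 2 + u / 2 = u := by omega
    have hle : u / 2 ≤ u / 2 * b := Nat.le_mul_of_pos_right _ hpos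
    have hsum : (u + 1) / 2 * b + u / 2 * b = u * b := by rw [← add_mul, hsplit]
    have key : u / 2 + c ≤ u * b := by omega
    zify at key
    push_cast
    linarith
  · have htwo : 2 ≤ binOnes (2 * l + 1) := by
      have := binOnes_pos (n := l) (by omega)
      rw [binOnes_two_mul_add_one]
      omega
    rw [show (2 * l + 1 + 1) / 2 = l + 1 by omega]
    generalize binOnes (2 * l + 1) = b at *
    generalize binOnes (u * (2 * l + 1)) = c at *
    obtain ⟨k, rfl | rfl⟩ := Nat.even_or_odd' u
    · rw [show (2 * k * (2 * l + 1) + 1) / 2 = k * (2 * l + 1) by rw [mul_assoc]; omega,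
        show 2 * k / 2 = k by omega]
      rw [show (2 * k + 1) / 2 = k by omega] at hbound
      zify at hbound htwo
      push_cast
      nlinarith
    · rw [show ((2 * k + 1) * (2 * l + 1) + 1) / 2 = 2 * (k * l) + k + l + 1 by
        rw [show (2 * k + 1) * (2 * l + 1) = 4 * (k * l) + 2 * k + 2 * l + 1 by ring]; omega,
        show (2 * k + 1) / 2 = k by omega]
      rw [show (2 * k + 1 + 1) / 2 = k + 1 by omega] at hbound
      zify at hbound htwo
      push_cast
      nlinarith
end

section
/- Let G be a finite connected cubic simple graph and let e be an edge of G whose orbit O(e) under the action of Aut(G) on the edge set has minimal cardinality among all edge orbits. Then at least one of the following holds: (i) O(e) is the entire edge set of G; (ii) O(e) is a disjoint union of stars, i.e., O(e) can be partitioned into triples, each triple consisting of the three edges incident to some common vertex, with distinct triples sharing no vertex; (iii) O(e) is a matching, i.e., its edges are pairwise non-adjacent; (iv) O(e) is the edge set of a collection of pairwise vertex-disjoint cycles in G, and any two distinct such cycles are at graph distance at least two from each other (no vertex of one cycle is adjacent to a vertex of another). -/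
/-- The orbit of an edge `e` (as an element of `Sym2 V`) under the action of
the automorphism group of `G`. -/
def edgeOrbit {V : Type} (G : SimpleGraph V) (e : Sym2 V) : Set (Sym2 V) :=
  {f | ∃ φ : G ≃g G, Sym2.map φ e = f}

/-- The number of edges of `A` that contain the vertex `v`. -/
noncomputable def edgeSetDegree {V : Type} (A : Set (Sym2 V)) (v : V) : ℕ :=
  {f ∈ A | v ∈ f}.ncard

section EdgeOrbit

variable {V : Type} {G : SimpleGraph V}

theorem mem_edgeOrbit_self (e : Sym2 V) : e ∈ edgeOrbit G e :=
  ⟨SimpleGraph.Iso.refl, by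
    change Sym2.map id e = e
    simp⟩

theorem map_mem_edgeOrbit {e f : Sym2 V} (φ : G ≃g G) (hf : f ∈ edgeOrbit G e) :
    Sym2.map φ f ∈ edgeOrbit G e := by
  obtain ⟨ψ, rfl⟩ := hf
  exact ⟨ψ.trans φ, by rw [Sym2.map_map]; rfl⟩

theorem mem_edgeOrbit_comm {e f : Sym2 V} (hf : f ∈ edgeOrbit G e) : e ∈ edgeOrbit G f := by
  obtain ⟨φ, rfl⟩ := hf
  refine ⟨φ.symm, ?_⟩
  have h : (φ.symm ∘ φ : V → V) = id := funext fun v => φ.symm_apply_apply v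
  rw [Sym2.map_map, h, Sym2.map_id, id]

theorem mem_edgeOrbit_trans {e f g : Sym2 V} (hf : f ∈ edgeOrbit G e) (hg : g ∈ edgeOrbit G f) :
    g ∈ edgeOrbit G e := by
  obtain ⟨φ, rfl⟩ := hg
  exact map_mem_edgeOrbit φ hf

theorem edgeOrbit_subset_edgeSet {e : Sym2 V} (he : e ∈ G.edgeSet) :
    edgeOrbit G e ⊆ G.edgeSet := by
  rintro _ ⟨φ, rfl⟩
  induction e with
  | h a b => exact φ.map_adj_iff.2 he

theorem disjoint_edgeOrbit {e f : Sym2 V} (hf : f ∉ edgeOrbit G e) :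
    Disjoint (edgeOrbit G e) (edgeOrbit G f) :=
  Set.disjoint_left.2 fun _ hx hy => hf (mem_edgeOrbit_trans hx (mem_edgeOrbit_comm hy))

theorem edgeSetDegree_apply (e : Sym2 V) (φ : G ≃g G) (v : V) :
    edgeSetDegree (edgeOrbit G e) (φ v) = edgeSetDegree (edgeOrbit G e) v := by
  have h : {f ∈ edgeOrbit G e | φ v ∈ f} = Sym2.map φ '' {f ∈ edgeOrbit G e | v ∈ f} := by
    ext f
    constructor
    · rintro ⟨hf, hv⟩
      have hφ : (φ ∘ φ.symm : V → V) = id := funext fun v => φ.apply_symm_apply v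
      refine ⟨Sym2.map φ.symm f, ⟨map_mem_edgeOrbit _ hf, ?_⟩, ?_⟩
      · exact Sym2.mem_map.2 ⟨φ v, hv, φ.symm_apply_apply v⟩
      · rw [Sym2.map_map, hφ, Sym2.map_id, id]
    · rintro ⟨g, ⟨hg, hv⟩, rfl⟩
      exact ⟨map_mem_edgeOrbit φ hg, Sym2.mem_map.2 ⟨v, hv, rfl⟩⟩
  rw [edgeSetDegree, h, Set.ncard_image_of_injective _ (Sym2.map.injective φ.injective)]
  rfl

/-- Every edge of the orbit of `e` meets an invariant vertex set in as many vertices as `e`. -/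
theorem ncard_inter_eq_of_mem_edgeOrbit {T : Set V} (hT : ∀ (φ : G ≃g G) v, φ v ∈ T ↔ v ∈ T)
    {e f : Sym2 V} (hf : f ∈ edgeOrbit G e) :
    {v ∈ T | v ∈ f}.ncard = {v ∈ T | v ∈ e}.ncard := by
  obtain ⟨φ, rfl⟩ := hf
  have h : {v ∈ T | v ∈ Sym2.map φ e} = φ '' {v ∈ T | v ∈ e} := by
    ext v
    constructor
    · rintro ⟨hv, hm⟩
      obtain ⟨w, hw, rfl⟩ := Sym2.mem_map.1 hm
      exact ⟨w, ⟨(hT φ w).1 hv, hw⟩, rfl⟩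
    · rintro ⟨w, ⟨hw, hm⟩, rfl⟩
      exact ⟨(hT φ w).2 hw, Sym2.mem_map.2 ⟨w, hm, rfl⟩⟩
  rw [h, Set.ncard_image_of_injective _ φ.injective]

theorem edgeSetDegree_eq_or_eq {a b v : V} {f : Sym2 V} (hf : f ∈ edgeOrbit G s(a, b))
    (hv : v ∈ f) :
    edgeSetDegree (edgeOrbit G s(a, b)) v = edgeSetDegree (edgeOrbit G s(a, b)) a ∨
      edgeSetDegree (edgeOrbit G s(a, b)) v = edgeSetDegree (edgeOrbit G s(a, b)) b := by
  obtain ⟨φ, rfl⟩ := hf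
  obtain ⟨w, hw, rfl⟩ := Sym2.mem_map.1 hv
  rw [edgeSetDegree_apply]
  rcases Sym2.mem_iff.1 hw with rfl | rfl
  · exact Or.inl rfl
  · exact Or.inr rfl

/-- The unordered pair of degrees at the two ends is constant on an edge orbit. -/
theorem map_edgeSetDegree_eq {e f : Sym2 V} (hf : f ∈ edgeOrbit G e) :
    f.map (edgeSetDegree (edgeOrbit G e)) = e.map (edgeSetDegree (edgeOrbit G e)) := by
  obtain ⟨φ, rfl⟩ := hf
  rw [Sym2.map_map]
  congr 1
  exact funext (edgeSetDegree_apply e φ)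

variable [Fintype V]

theorem sum_edgeSetDegree (A : Set (Sym2 V)) (T : Set V) [Fintype T] {k : ℕ}
    (h : ∀ f ∈ A, {v ∈ T | v ∈ f}.ncard = k) :
    ∑ v ∈ T.toFinset, edgeSetDegree A v = A.ncard * k := by
  classical
  have key := Finset.sum_card_bipartiteAbove_eq_sum_card_bipartiteBelow
    (s := T.toFinset) (t := A.toFinset) (fun v f => v ∈ f)
  have h₁ : ∀ v ∈ T.toFinset,
      (A.toFinset.bipartiteAbove (fun v f => v ∈ f) v).card = edgeSetDegree A v := by
    intro v _
    rw [edgeSetDegree, ← Set.ncard_coe_finset]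
    congr 1
    ext f
    simp [Finset.bipartiteAbove]
  have h₂ : ∀ f ∈ A.toFinset,
      (T.toFinset.bipartiteBelow (fun v f => v ∈ f) f).card = k := by
    intro f hf
    rw [← h f (Set.mem_toFinset.1 hf), ← Set.ncard_coe_finset]
    congr 1
    ext v
    simp [Finset.bipartiteBelow]
  rw [Finset.sum_congr rfl h₁, Finset.sum_congr rfl h₂] at key
  rw [key, Finset.sum_const, smul_eq_mul, Set.ncard_eq_toFinset_card']

theorem edgeSetDegree_pos {A : Set (Sym2 V)} {f : Sym2 V} {v : V} (hf : f ∈ A) (hv : v ∈ f) :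
    0 < edgeSetDegree A v :=
  (Set.ncard_pos (Set.toFinite _)).2 ⟨f, hf, hv⟩

theorem edgeSetDegree_mono {A B : Set (Sym2 V)} (h : A ⊆ B) (v : V) :
    edgeSetDegree A v ≤ edgeSetDegree B v :=
  Set.ncard_le_ncard (fun _ hf => ⟨h hf.1, hf.2⟩) (Set.toFinite _)

omit [Fintype V] in
theorem edgeSetDegree_edgeSet (v : V) :
    edgeSetDegree G.edgeSet v = (G.neighborSet v).ncard := by
  classical
  exact Nat.card_congr (G.incidenceSetEquivNeighborSet v)

theorem edgeSetDegree_add_le {A B : Set (Sym2 V)} (hA : A ⊆ G.edgeSet) (hB : B ⊆ G.edgeSet)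
    (hAB : Disjoint A B) (v : V) :
    edgeSetDegree A v + edgeSetDegree B v ≤ (G.neighborSet v).ncard := by
  rw [← edgeSetDegree_edgeSet, edgeSetDegree, edgeSetDegree,
    ← Set.ncard_union_eq (hAB.mono (Set.sep_subset _ _) (Set.sep_subset _ _))
      (Set.toFinite _) (Set.toFinite _)]
  refine Set.ncard_le_ncard ?_ (Set.toFinite _)
  rintro f (hf | hf)
  · exact ⟨hA hf.1, hf.2⟩
  · exact ⟨hB hf.1, hf.2⟩

theorem mem_of_edgeSetDegree_eq {A : Set (Sym2 V)} (hA : A ⊆ G.edgeSet) {v : V}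
    (h : edgeSetDegree A v = (G.neighborSet v).ncard) {f : Sym2 V} (hf : f ∈ G.edgeSet)
    (hv : v ∈ f) : f ∈ A := by
  rw [← edgeSetDegree_edgeSet] at h
  have hs : {g ∈ A | v ∈ g} = {g ∈ G.edgeSet | v ∈ g} :=
    Set.eq_of_subset_of_ncard_le (fun g hg => ⟨hA hg.1, hg.2⟩) h.ge (Set.toFinite _)
  have hm : f ∈ {g ∈ G.edgeSet | v ∈ g} := ⟨hf, hv⟩
  rw [← hs] at hm
  exact hm.1

theorem exists_mem_edgeSet_notMem {A : Set (Sym2 V)} {v : V}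
    (h : edgeSetDegree A v < (G.neighborSet v).ncard) : ∃ f ∈ G.edgeSet, v ∈ f ∧ f ∉ A := by
  by_contra! hA
  rw [← edgeSetDegree_edgeSet] at h
  exact h.not_ge (Set.ncard_le_ncard (fun f hf => ⟨hA f hf.1 hf.2, hf.2⟩) (Set.toFinite _))

/-- An edge outside a minimal edge orbit meets the set of vertices of orbit degree two at most
half as often as the edges of the orbit do. -/
theorem two_mul_ncard_le_of_minimal (hcubic : ∀ v : V, (G.neighborSet v).ncard = 3)
    {e f : Sym2 V} (he : e ∈ G.edgeSet) (hf : f ∈ G.edgeSet) (hfe : f ∉ edgeOrbit G e)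
    (hmin : (edgeOrbit G e).ncard ≤ (edgeOrbit G f).ncard) :
    2 * {v ∈ {v | edgeSetDegree (edgeOrbit G e) v = 2} | v ∈ f}.ncard ≤
      {v ∈ {v | edgeSetDegree (edgeOrbit G e) v = 2} | v ∈ e}.ncard := by
  classical
  set T := {v | edgeSetDegree (edgeOrbit G e) v = 2} with hTdef
  have hT : ∀ (φ : G ≃g G) v, φ v ∈ T ↔ v ∈ T := fun φ v => by
    simp [hTdef, edgeSetDegree_apply]
  have hP := sum_edgeSetDegree (edgeOrbit G f) T
    fun _ hx => ncard_inter_eq_of_mem_edgeOrbit hT hx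
  have hO := sum_edgeSetDegree (edgeOrbit G e) T
    fun _ hx => ncard_inter_eq_of_mem_edgeOrbit hT hx
  have hO' : ∑ v ∈ T.toFinset, edgeSetDegree (edgeOrbit G e) v = T.toFinset.card * 2 :=
    Finset.sum_const_nat fun v hv => Set.mem_toFinset (s := T).1 hv
  have hP' : ∑ v ∈ T.toFinset, edgeSetDegree (edgeOrbit G f) v ≤ T.toFinset.card * 1 := by
    refine Finset.sum_le_card_nsmul _ _ 1 fun v hv => ?_
    have h₂ : edgeSetDegree (edgeOrbit G e) v = 2 := Set.mem_toFinset (s := T).1 hv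
    have h₃ := edgeSetDegree_add_le (edgeOrbit_subset_edgeSet he) (edgeOrbit_subset_edgeSet hf)
      (disjoint_edgeOrbit hfe) v
    rw [hcubic, h₂] at h₃
    omega
  have hpos : 0 < (edgeOrbit G e).ncard :=
    (Set.ncard_pos (Set.toFinite _)).2 ⟨e, mem_edgeOrbit_self e⟩
  have hmul := Nat.mul_le_mul_right {v ∈ T | v ∈ f}.ncard hmin
  refine le_of_mul_le_mul_left ?_ hpos
  rw [mul_left_comm]
  omega

end EdgeOrbit

theorem structure_minimal_orbit {V : Type} [Fintype V] (G : SimpleGraph V)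
    (hconn : G.Connected) (hcubic : ∀ v : V, (G.neighborSet v).ncard = 3)
    (e : Sym2 V) (he : e ∈ G.edgeSet)
    (hmin : ∀ f ∈ G.edgeSet, (edgeOrbit G e).ncard ≤ (edgeOrbit G f).ncard) :
    -- (i) the orbit is the whole edge set
    edgeOrbit G e = G.edgeSet ∨
    -- (ii) the orbit is a disjoint union of stars: there is a set `S` of
    -- centers; the orbit consists exactly of the edges incident to a center,
    -- and the stars at distinct centers share no vertex
    (∃ S : Set V,
      edgeOrbit G e = {f | f ∈ G.edgeSet ∧ ∃ v ∈ S, v ∈ f} ∧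
      ∀ v ∈ S, ∀ w ∈ S, v ≠ w →
        Disjoint (insert v (G.neighborSet v)) (insert w (G.neighborSet w))) ∨
    -- (iii) the orbit is a matching: its edges are pairwise non-adjacent
    (∀ f₁ ∈ edgeOrbit G e, ∀ f₂ ∈ edgeOrbit G e, f₁ ≠ f₂ →
      ∀ v : V, v ∈ f₁ → v ∈ f₂ → False) ∨
    -- (iv) the orbit is the edge set of a disjoint union of cycles (every
    -- vertex covered by the orbit lies on exactly two orbit edges), and two
    -- distinct cycles are at distance at least two: covered vertices that are
    -- adjacent in `G` but not connected through orbit edges do not exist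
    ((∀ v : V, (∃ f ∈ edgeOrbit G e, v ∈ f) →
        {f ∈ edgeOrbit G e | v ∈ f}.ncard = 2) ∧
      ∀ u w : V, (∃ f ∈ edgeOrbit G e, u ∈ f) → (∃ f ∈ edgeOrbit G e, w ∈ f) →
        ¬ (SimpleGraph.fromEdgeSet (edgeOrbit G e)).Reachable u w →
        ¬ G.Adj u w) := by
  induction e with
  | h a b =>
  set O := edgeOrbit G s(a, b)
  set d := edgeSetDegree O
  have hsub : O ⊆ G.edgeSet := edgeOrbit_subset_edgeSet he
  have hself : s(a, b) ∈ O := mem_edgeOrbit_self _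
  have hle : ∀ v, d v ≤ 3 := fun v => by
    rw [← hcubic v, ← edgeSetDegree_edgeSet]
    exact edgeSetDegree_mono hsub v
  have ha : 0 < d a := edgeSetDegree_pos hself (Sym2.mem_mk_left a b)
  have hb : 0 < d b := edgeSetDegree_pos hself (Sym2.mem_mk_right a b)
  have hab : ∀ f ∈ O, ∀ v ∈ f, d v = d a ∨ d v = d b := fun f hf v hv =>
    edgeSetDegree_eq_or_eq hf hv
  have hpair : ∀ u w, s(u, w) ∈ O → d u = d a ∧ d w = d b ∨ d u = d b ∧ d w = d a :=
    fun u w h => by simpa using map_edgeSetDegree_eq h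
  have hfull : ∀ v, d v = 3 → ∀ f ∈ G.edgeSet, v ∈ f → f ∈ O := fun v hv f hf hvf =>
    mem_of_edgeSetDegree_eq hsub (hv.trans (hcubic v).symm) hf hvf
  by_cases h2 : d a = 2 ∨ d b = 2
  · right; right; right
    obtain ⟨v, hv⟩ : ∃ v, d v = 2 := h2.elim (fun h => ⟨a, h⟩) (fun h => ⟨b, h⟩)
    have key : ∀ f ∈ G.edgeSet, f ∉ O →
        2 * {v ∈ {v | d v = 2} | v ∈ f}.ncard ≤ {v ∈ {v | d v = 2} | v ∈ s(a, b)}.ncard :=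
      fun f hf hfO => two_mul_ncard_le_of_minimal hcubic he hf hfO (hmin f hf)
    have hc : {v ∈ {v | d v = 2} | v ∈ s(a, b)}.ncard ≤ ({a, b} : Set V).ncard :=
      Set.ncard_le_ncard (fun x hx => by simpa using hx.2) (Set.toFinite _)
    rw [Set.ncard_pair (G.ne_of_adj he)] at hc
    obtain ⟨f, hf, hvf, hfO⟩ := exists_mem_edgeSet_notMem (A := O) (v := v) (G := G)
      (by rw [hcubic]; exact hv.trans_lt (by norm_num))
    have hone : 0 < {v ∈ {v | d v = 2} | v ∈ f}.ncard :=
      (Set.ncard_pos (Set.toFinite _)).2 ⟨v, hv, hvf⟩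
    have htwo := key f hf hfO
    have hda : d a = 2 := by
      by_contra hne
      have : {v ∈ {v | d v = 2} | v ∈ s(a, b)}.ncard ≤ ({b} : Set V).ncard := by
        refine Set.ncard_le_ncard (fun x hx => ?_) (Set.toFinite _)
        rcases Sym2.mem_iff.1 hx.2 with rfl | rfl
        · exact absurd hx.1 hne
        · rfl
      rw [Set.ncard_singleton] at this
      omega
    have hdb : d b = 2 := by
      by_contra hne
      have : {v ∈ {v | d v = 2} | v ∈ s(a, b)}.ncard ≤ ({a} : Set V).ncard := by
        refine Set.ncard_le_ncard (fun x hx => ?_) (Set.toFinite _)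
        rcases Sym2.mem_iff.1 hx.2 with rfl | rfl
        · rfl
        · exact absurd hx.1 hne
      rw [Set.ncard_singleton] at this
      omega
    have hcov : ∀ v, (∃ f ∈ O, v ∈ f) → d v = 2 := by
      rintro v ⟨f, hf, hv⟩
      rcases hab f hf v hv with h | h <;> omega
    refine ⟨hcov, fun u w hu hw hreach hadj => ?_⟩
    have huw : s(u, w) ∉ O := fun h =>
      hreach (SimpleGraph.Adj.reachable ((SimpleGraph.fromEdgeSet_adj O).2 ⟨h, hadj.ne⟩))
    have hk : ({u, w} : Set V).ncard ≤ {v ∈ {v | d v = 2} | v ∈ s(u, w)}.ncard := by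
      refine Set.ncard_le_ncard (fun x hx => ?_) (Set.toFinite _)
      rcases hx with rfl | rfl
      · exact ⟨hcov _ hu, Sym2.mem_mk_left _ _⟩
      · exact ⟨hcov _ hw, Sym2.mem_mk_right _ _⟩
    rw [Set.ncard_pair hadj.ne] at hk
    have := key s(u, w) hadj huw
    omega
  · push Not at h2
    have hla := hle a
    have hlb := hle b
    by_cases h11 : d a = 1 ∧ d b = 1
    · right; right; left
      intro f₁ hf₁ f₂ hf₂ hne v hv₁ hv₂
      have h1 : d v = 1 := by rcases hab f₁ hf₁ v hv₁ with h | h <;> omega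
      obtain ⟨g, hg⟩ := Set.ncard_eq_one.1 h1
      have e₁ : f₁ ∈ ({g} : Set (Sym2 V)) := hg ▸ ⟨hf₁, hv₁⟩
      have e₂ : f₂ ∈ ({g} : Set (Sym2 V)) := hg ▸ ⟨hf₂, hv₂⟩
      exact hne (e₁.trans e₂.symm)
    by_cases h33 : d a = 3 ∧ d b = 3
    · left
      have hstep : ∀ u w, G.Adj u w → d w = 3 → d u = 3 := fun u w h hw => by
        rcases hab _ (hfull w hw s(u, w) h (Sym2.mem_mk_right u w)) u (Sym2.mem_mk_left u w)
          with h | h <;> omega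
      have hwalk : ∀ u w, G.Walk u w → d w = 3 → d u = 3 := fun u w p hw => by
        induction p with
        | nil => exact hw
        | cons h _ ih => exact hstep _ _ h (ih hw)
      have hall : ∀ v, d v = 3 := fun v =>
        (hconn.preconnected v a).elim fun p => hwalk v a p h33.1
      refine hsub.antisymm fun f hf => ?_
      induction f with
      | h x y => exact hfull x (hall x) _ hf (Sym2.mem_mk_left x y)
    · right; left
      have hnbr : ∀ v, d v = 3 → ∀ u, G.Adj v u → s(v, u) ∈ O ∧ d u = 1 := fun v hv u hu => by
        have hm := hfull v hv s(v, u) hu (Sym2.mem_mk_left v u)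
        have := hpair v u hm
        exact ⟨hm, by omega⟩
      refine ⟨{v | d v = 3}, Set.ext fun f => ⟨fun hf => ⟨hsub hf, ?_⟩, ?_⟩, ?_⟩
      · induction f with
        | h x y =>
          have := hpair x y hf
          by_cases hx : d x = 3
          · exact ⟨x, hx, Sym2.mem_mk_left x y⟩
          · exact ⟨y, show d y = 3 by omega, Sym2.mem_mk_right x y⟩
      · rintro ⟨hf, v, hv, hvf⟩
        exact hfull v hv f hf hvf
      · intro v hv w hw hvw
        refine Set.disjoint_left.2 fun x hx hy => ?_
        rcases hx with rfl | hx <;> rcases hy with rfl | hy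
        · exact hvw rfl
        · exact absurd (hnbr w hw _ hy).2 (by rw [show d x = 3 from hv]; norm_num)
        · exact absurd (hnbr v hv _ hx).2 (by rw [show d x = 3 from hw]; norm_num)
        · obtain ⟨h₁, hx1⟩ := hnbr v hv x hx
          obtain ⟨h₂, -⟩ := hnbr w hw x hy
          obtain ⟨g, hg⟩ := Set.ncard_eq_one.1 hx1
          have e₁ : s(v, x) ∈ ({g} : Set (Sym2 V)) := hg ▸ ⟨h₁, Sym2.mem_mk_right v x⟩
          have e₂ : s(w, x) ∈ ({g} : Set (Sym2 V)) := hg ▸ ⟨h₂, Sym2.mem_mk_right w x⟩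
          exact hvw (Sym2.congr_left.1 (e₁.trans e₂.symm))
end

section
/- Every finite connected cubic simple graph on 8 vertices has at most 48 automorphisms, and this bound is attained by some connected cubic simple graph on 8 vertices (the 3-dimensional cube graph). -/
/-- The 8-bit masks with exactly three bits set. -/
def tripleMasks : List ℕ := [7, 11, 13, 14, 19, 21, 22, 25, 26, 28, 35, 37, 38, 41, 42, 44, 49, 50,
  52, 56, 67, 69, 70, 73, 74, 76, 81, 82, 84, 88, 97, 98, 100, 104, 112, 131, 133, 134, 137, 138,
  140, 145, 146, 148, 152, 161, 162, 164, 168, 176, 193, 194, 196, 200, 208, 224]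

/-- Whether sending the next vertex, with adjacency row `r`, to the vertex `x`, with adjacency row
`s`, extends the partial map whose values from index `j` on are listed in the last but one
argument. -/
def extendsMap (r s x : ℕ) : List ℕ → ℕ → Bool
  | [], _ => true
  | y :: l, j => !(y.beq x) && !((r.testBit j).xor (s.testBit y)) && extendsMap r s x l (j + 1)

/-- The lists of images of `0, …, k - 1` under injections into the vertex set preserving adjacency
and non-adjacency, where the graph is given by the bit masks `rows`. -/
def partialMaps (rows : List ℕ) : ℕ → List (List ℕ)
  | 0 => [[]]
  | k + 1 => (partialMaps rows k).flatMap fun l =>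
      ([0, 1, 2, 3, 4, 5, 6, 7].filter fun x =>
        extendsMap (rows.getD k 0) (rows.getD x 0) x l 0).map fun x => l ++ [x]

/-- Whether the mask `r` as row `k` of an adjacency matrix is symmetric to the entries of `rows`,
which are the rows from index `j` up to `k - 1`, and has no diagonal entry. -/
def symmetricRow (r k : ℕ) : List ℕ → ℕ → Bool
  | [], j => !r.testBit j
  | s :: rows, j => !((r.testBit j).xor (s.testBit k)) && symmetricRow r k rows (j + 1)

/-- Whether `p` holds for all extensions by `n` rows of the first `k` rows of the adjacency matrix
of a cubic graph. -/
def forallExtensions (p : List ℕ → Bool) : ℕ → ℕ → List ℕ → Bool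
  | 0, _, rows => p rows
  | n + 1, k, rows => tripleMasks.all fun r =>
      !symmetricRow r k rows 0 || forallExtensions p n (k + 1) (rows ++ [r])

/-- Whether the graph with the given rows has the clique `{0, 1, 2, 3}` or at most 48
automorphisms. -/
def fewAutomorphisms (rows : List ℕ) : Bool :=
  ((rows.getD 1 0).beq 13 && (rows.getD 2 0).beq 11) || (partialMaps rows 8).length.ble 48

/-- The adjacencies of vertex `j` to the vertices `1, 2, 3`, as a binary number. -/
def columnKey (rows : List ℕ) (j : ℕ) : ℕ :=
  4 * ((rows.getD 1 0).testBit j).toNat + 2 * ((rows.getD 2 0).testBit j).toNat +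
    ((rows.getD 3 0).testBit j).toNat

/-- Whether the vertices `4, …, 7` are sorted by decreasing `columnKey`. -/
def columnsSorted (rows : List ℕ) : Bool :=
  [4, 5, 6].all fun j => (columnKey rows (j + 1)).ble (columnKey rows j)

theorem forallExtensions_fewAutomorphisms :
    forallExtensions
      (fun rows => !columnsSorted rows || forallExtensions fewAutomorphisms 4 4 rows) 3 1 [14] =
      true := by
  decide +kernel

theorem symmetricRow_eq_true {r k : ℕ} {rows : List ℕ} {j : ℕ}
    (h : ∀ i (hi : i < rows.length), r.testBit (j + i) = rows[i].testBit k)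
    (hd : r.testBit (j + rows.length) = false) : symmetricRow r k rows j = true := by
  induction rows generalizing j with
  | nil => simpa [symmetricRow] using hd
  | cons s rows ih =>
    have h0 := h 0 (by simp)
    simp only [Nat.add_zero, List.getElem_cons_zero] at h0
    have := ih (j := j + 1) (fun i hi => by
      have := h (i + 1) (by simpa using hi)
      rw [show j + 1 + i = j + (i + 1) by omega, this]; simp)
      (by rw [← hd]; congr 1; simp; omega)
    simp [symmetricRow, h0, this]

theorem extendsMap_eq_true {r s x : ℕ} {l : List ℕ} {j : ℕ}
    (h : ∀ i (hi : i < l.length), l[i] ≠ x ∧ r.testBit (j + i) = s.testBit l[i]) :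
    extendsMap r s x l j = true := by
  induction l generalizing j with
  | nil => rfl
  | cons y l ih =>
    have h0 := h 0 (by simp)
    simp only [Nat.add_zero, List.getElem_cons_zero] at h0
    have := ih (j := j + 1) (fun i hi => by
      have := h (i + 1) (by simpa using hi)
      rw [show j + 1 + i = j + (i + 1) by omega]; simpa using this)
    have hyx : y.beq x = false := Bool.eq_false_iff.2 fun hb => h0.1 (Nat.eq_of_beq_eq_true hb)
    simp [extendsMap, h0.2, hyx, this]

theorem of_forallExtensions {p : List ℕ → Bool} {r : ℕ → ℕ} (hmem : ∀ i, r i ∈ tripleMasks)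
    (hsymm : ∀ i < 8, ∀ j < 8, (r i).testBit j = (r j).testBit i)
    (hloop : ∀ i < 8, (r i).testBit i = false) {n k : ℕ} (hnk : k + n ≤ 8)
    (h : forallExtensions p n k ((List.range k).map r) = true) :
    p ((List.range (k + n)).map r) = true := by
  induction n generalizing k with
  | zero => simpa [forallExtensions] using h
  | succ n ih =>
    rw [forallExtensions, List.all_eq_true] at h
    have hk := h (r k) (hmem k)
    rw [symmetricRow_eq_true (fun i hi => by
      simp only [List.length_map, List.length_range] at hi
      simpa using hsymm k (by omega) i (by omega)) (by simpa using hloop k (by omega))] at hk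
    have := ih (k := k + 1) (by omega) (by simpa [List.range_succ] using hk)
    rwa [show k + 1 + n = k + (n + 1) by omega] at this

theorem map_range_mem_partialMaps {r σ : ℕ → ℕ} (hσ : ∀ i, σ i < 8)
    (hinj : ∀ i < 8, ∀ j < 8, σ i = σ j → i = j)
    (hadj : ∀ i < 8, ∀ j < 8, (r i).testBit j = (r (σ i)).testBit (σ j)) {k : ℕ} (hk : k ≤ 8) :
    (List.range k).map σ ∈ partialMaps ((List.range 8).map r) k := by
  induction k with
  | zero => simp [partialMaps]
  | succ k ih =>
    rw [partialMaps, List.mem_flatMap]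
    refine ⟨_, ih (by omega), List.mem_map.2 ⟨σ k, List.mem_filter.2 ⟨?_, ?_⟩, ?_⟩⟩
    · have := hσ k
      interval_cases σ k <;> simp
    · refine extendsMap_eq_true fun i hi => ?_
      simp only [List.length_map, List.length_range] at hi
      have hr : ∀ m < 8, ((List.range 8).map r).getD m 0 = r m := fun m hm => by
        simp [List.getD, hm]
      rw [hr k (by omega), hr _ (hσ k)]
      refine ⟨?_, by simpa using hadj k (by omega) i (by omega)⟩
      intro he
      have := hinj i (by omega) k (by omega) (by simpa using he)
      omega
    · simp [List.range_succ]

theorem exists_tripleMask : ∀ s : Finset (Fin 8), s.card = 3 →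
    ∃ m ∈ tripleMasks, ∀ j : Fin 8, m.testBit j = decide (j ∈ s) := by
  decide +kernel

theorem tripleMask_ext : ∀ m ∈ tripleMasks, ∀ m' ∈ tripleMasks,
    (∀ j : Fin 8, m.testBit j = m'.testBit j) → m = m' := by
  decide +kernel

/-- The adjacencies of `x` to `a`, `b`, `c`, as a binary number. -/
noncomputable def SimpleGraph.adjKey {V : Type*} (G : SimpleGraph V) (a b c x : V) : ℕ :=
  open Classical in
  4 * (decide (G.Adj a x)).toNat + 2 * (decide (G.Adj b x)).toNat + (decide (G.Adj c x)).toNat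

theorem exists_labelling {V : Type*} [Fintype V] (hV : Fintype.card V = 8) (G : SimpleGraph V)
    (hG : ∀ v, (G.neighborSet v).ncard = 3) :
    ∃ e : Fin 8 ≃ V, (∀ j, G.Adj (e 0) (e j) ↔ j = 1 ∨ j = 2 ∨ j = 3) ∧
      ∀ j ∈ [4, 5, 6], G.adjKey (e 1) (e 2) (e 3) (e (j + 1)) ≤
        G.adjKey (e 1) (e 2) (e 3) (e j) := by
  classical
  obtain ⟨v⟩ : Nonempty V := Fintype.card_pos_iff.1 (by omega)
  obtain ⟨a, b, c, hab, hac, hbc, hN⟩ := Set.ncard_eq_three.1 (hG v)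
  have hN' : ∀ w, G.Adj v w ↔ w = a ∨ w = b ∨ w = c := fun w => by
    rw [← G.mem_neighborSet, hN]; simp
  have hva : v ≠ a := ((hN' a).2 (by simp)).ne
  have hvb : v ≠ b := ((hN' b).2 (by simp)).ne
  have hvc : v ≠ c := ((hN' c).2 (by simp)).ne
  let S : Finset V := {v, a, b, c}
  have hS : S.card = 4 := by
    simp [S, hva, hvb, hvc, hab, hac, hbc]
  let R : V → V → Prop := fun x y => G.adjKey a b c y ≤ G.adjKey a b c x
  have hRt : Std.Total R := ⟨fun x y => le_total _ _⟩
  have hRtr : IsTrans V R := ⟨fun x y z h h' => le_trans h' h⟩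
  let l := (Sᶜ).toList.insertionSort R
  have hperm : l.Perm (Sᶜ).toList := List.perm_insertionSort _ _
  have hsort : l.Pairwise R := List.pairwise_insertionSort _ _
  have hlen : l.length = 4 := by
    rw [hperm.length_eq, Finset.length_toList, Finset.card_compl]; omega
  have hnd : l.Nodup := hperm.nodup_iff.2 (Finset.nodup_toList _)
  have hmem : ∀ x, x ∈ l ↔ ¬(x = v ∨ x = a ∨ x = b ∨ x = c) := fun x => by
    rw [hperm.mem_iff]; simp [S]
  clear_value l
  obtain ⟨d, f, g, h, rfl⟩ : ∃ d f g h, l = [d, f, g, h] := by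
    match l, hlen with
    | [d, f, g, h], _ => exact ⟨d, f, g, h, rfl⟩
  have hd := (hmem d).1 (by simp)
  have hf := (hmem f).1 (by simp)
  have hg := (hmem g).1 (by simp)
  have hh := (hmem h).1 (by simp)
  push Not at hd hf hg hh
  have hall : [v, a, b, c, d, f, g, h].Nodup := by
    simp only [List.nodup_cons, List.mem_cons, List.not_mem_nil, or_false] at hnd ⊢
    grind
  let e : Fin 8 ≃ V := hall.getEquivOfForallMemList _ fun x => by
    have := hmem x
    simp only [List.mem_cons, List.not_mem_nil, or_false] at this ⊢
    tauto
  refine ⟨e, fun j => ?_, ?_⟩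
  · rw [show e 0 = v from rfl, hN', show a = e 1 from rfl, show b = e 2 from rfl,
      show c = e 3 from rfl]
    simp only [e.injective.eq_iff]
  · simp only [List.pairwise_cons, List.mem_cons, List.not_mem_nil, or_false, forall_eq_or_imp,
      forall_eq] at hsort ⊢
    exact ⟨hsort.1.1, hsort.2.1.1, hsort.2.2.1⟩

theorem card_aut_le_of_labelling {V : Type*} {G : SimpleGraph V} (hconn : G.Connected)
    (hG : ∀ v, (G.neighborSet v).ncard = 3) (e : Fin 8 ≃ V)
    (h0 : ∀ j, G.Adj (e 0) (e j) ↔ j = 1 ∨ j = 2 ∨ j = 3)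
    (hsort : ∀ j ∈ [4, 5, 6], G.adjKey (e 1) (e 2) (e 3) (e (j + 1)) ≤
        G.adjKey (e 1) (e 2) (e 3) (e j)) :
    Nat.card (G ≃g G) ≤ 48 := by
  classical
  have hrow : ∀ i : Fin 8, ∃ m ∈ tripleMasks, ∀ j : Fin 8,
      m.testBit j = decide (G.Adj (e i) (e j)) := fun i => by
    have hcard : (Finset.univ.filter fun j => G.Adj (e i) (e j)).card = 3 := by
      rw [← hG (e i), ← Set.ncard_coe_finset, ← Set.ncard_image_of_injective _ e.injective]
      congr 1
      ext w
      simp only [Finset.coe_filter, Finset.mem_univ, true_and, Set.mem_image, Set.mem_ofPred_eq,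
        SimpleGraph.mem_neighborSet]
      exact ⟨fun ⟨j, hj, hw⟩ => hw ▸ hj, fun hw => ⟨e.symm w, by simpa using hw, by simp⟩⟩
    simpa using exists_tripleMask _ hcard
  choose m hm hbit using hrow
  let q : ℕ → Fin 8 := Fin.ofNat 8
  have hq : ∀ i < 8, (q i : ℕ) = i := fun i hi => Nat.mod_eq_of_lt hi
  have hqv : ∀ i : Fin 8, q i = i := fun i => Fin.ext (hq i i.2)
  let r : ℕ → ℕ := fun i => m (q i)
  have hr : ∀ i, ∀ j < 8, (r i).testBit j = decide (G.Adj (e (q i)) (e (q j))) := fun i j hj => by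
    rw [← hbit, hq j hj]
  have hmem : ∀ i, r i ∈ tripleMasks := fun i => hm _
  have hsymm : ∀ i < 8, ∀ j < 8, (r i).testBit j = (r j).testBit i := fun i hi j hj => by
    rw [hr i j hj, hr j i hi]; simp only [G.adj_comm]
  have hloop : ∀ i < 8, (r i).testBit i = false := fun i hi => by simp [hr i i hi]
  have hr0 : r 0 = 14 := by
    refine tripleMask_ext _ (hmem 0) 14 (by simp [tripleMasks]) fun j => ?_
    rw [hr 0 j j.2, hqv, show q 0 = 0 from rfl]
    simp only [h0]
    revert j; decide
  have hfirst := of_forallExtensions hmem hsymm hloop (n := 3) (k := 1) (by norm_num)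
    (by simpa [hr0] using forallExtensions_fewAutomorphisms)
  have hcols : columnsSorted ((List.range (1 + 3)).map r) = true := by
    have key : ∀ j < 8, columnKey ((List.range (1 + 3)).map r) j =
        G.adjKey (e 1) (e 2) (e 3) (e (q j)) := fun j hj => by
      have h1 := hr 1 j hj
      have h2 := hr 2 j hj
      have h3 := hr 3 j hj
      simp only [columnKey, SimpleGraph.adjKey]
      rw [show q 1 = 1 from rfl] at h1
      rw [show q 2 = 2 from rfl] at h2
      rw [show q 3 = 3 from rfl] at h3
      rw [← h1, ← h2, ← h3]
      rfl
    simp only [List.mem_cons, List.not_mem_nil, or_false, forall_eq_or_imp, forall_eq] at hsort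
    simp only [columnsSorted, List.all_cons, List.all_nil, Bool.and_true, Bool.and_eq_true,
      Nat.ble_eq]
    rw [key 4 (by norm_num), key 5 (by norm_num), key 6 (by norm_num), key 7 (by norm_num)]
    exact hsort
  rw [hcols] at hfirst
  have hfew := of_forallExtensions hmem hsymm hloop (n := 4) (k := 4) (by norm_num)
    (by simpa using hfirst)
  rw [fewAutomorphisms, Bool.or_eq_true, Bool.and_eq_true, Nat.ble_eq] at hfew
  rcases hfew with ⟨h1, h2⟩ | hcard
  · exfalso
    replace h1 : r 1 = 13 := Nat.eq_of_beq_eq_true h1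
    replace h2 : r 2 = 11 := Nat.eq_of_beq_eq_true h2
    have h3 : r 3 = 7 := by
      have b0 := hsymm 3 (by norm_num) 0 (by norm_num)
      have b1 := hsymm 3 (by norm_num) 1 (by norm_num)
      have b2 := hsymm 3 (by norm_num) 2 (by norm_num)
      rw [hr0] at b0; rw [h1] at b1; rw [h2] at b2
      have := hmem 3
      have aux : ∀ x ∈ tripleMasks, x.testBit 0 = (14).testBit 3 → x.testBit 1 = (13).testBit 3 →
        x.testBit 2 = (11).testBit 3 → x = 7 := by decide +kernel
      exact aux _ this b0 b1 b2
    have hclosed : ∀ i : Fin 8, i < 4 → ∀ j, G.Adj (e i) (e j) → j < 4 := fun i hi j hij => by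
      have hb := hr i j j.2
      rw [hqv, hqv, decide_eq_true hij] at hb
      have aux : ∀ j : Fin 8, (14).testBit j ∨ (13).testBit j ∨ (11).testBit j ∨ (7).testBit j →
        j < 4 := by decide +kernel
      apply aux
      fin_cases i
      · left; rw [← hr0]; exact hb
      · right; left; rw [← h1]; exact hb
      · right; right; left; rw [← h2]; exact hb
      · right; right; right; rw [← h3]; exact hb
      all_goals exact absurd hi (by decide)
    have hreach : ∀ w, Relation.ReflTransGen G.Adj (e 0) w → e.symm w < 4 := fun w hw => by
      induction hw with
      | refl => simp
      | @tail x y _ hxy ih => exact hclosed _ ih _ (by simpa using hxy)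
    have := hreach (e 4) ((SimpleGraph.reachable_iff_reflTransGen _ _).1 (hconn _ _))
    simp at this
  · let σ : (G ≃g G) → ℕ → ℕ := fun φ i => e.symm (φ (e (q i)))
    have hqσ : ∀ φ i, e (q (σ φ i)) = φ (e (q i)) := fun φ i => by simp [σ, hqv]
    have hqinj : ∀ i < 8, ∀ j < 8, q i = q j → i = j := fun i hi j hj h => by
      rw [← hq i hi, ← hq j hj, h]
    have hσmem : ∀ φ, (List.range 8).map (σ φ) ∈
        (partialMaps ((List.range 8).map r) 8).toFinset := fun φ => by
      rw [List.mem_toFinset]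
      refine map_range_mem_partialMaps (fun i => Fin.is_lt _) (fun i hi j hj h => ?_)
        (fun i hi j hj => ?_) le_rfl
      · exact hqinj i hi j hj (e.injective (φ.injective (by rw [← hqσ, ← hqσ]; exact congrArg (fun n => e (q n)) h)))
      · rw [hr i j hj, hr _ _ (Fin.is_lt _), hqσ, hqσ]
        simp only [φ.map_adj_iff]
    calc Nat.card (G ≃g G)
        ≤ Nat.card (partialMaps ((List.range 8).map r) 8).toFinset :=
          Nat.card_le_card_of_injective (fun φ => ⟨_, hσmem φ⟩) fun φ ψ h => by
            simp only [Subtype.mk.injEq, List.map_inj_left, List.mem_range] at h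
            ext v
            have := congrArg (fun i => e (q i)) (h (e.symm v) (Fin.is_lt _))
            simpa only [hqσ, hqv, Equiv.apply_symm_apply] using this
      _ ≤ 48 := by
          rw [Nat.card_eq_fintype_card, Fintype.card_coe]
          exact (List.toFinset_card_le _).trans hcard

/-- The 3-dimensional cube graph, with vertices encoded in binary. -/
def cubeGraph : SimpleGraph (Fin 8) where
  Adj i j := i ^^^ j = 1 ∨ i ^^^ j = 2 ∨ i ^^^ j = 4
  symm := ⟨by decide⟩
  loopless := ⟨by decide⟩

instance : DecidableRel cubeGraph.Adj := fun i j =>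
  inferInstanceAs (Decidable (i ^^^ j = 1 ∨ i ^^^ j = 2 ∨ i ^^^ j = 4))

/-- The symmetry of the cube permuting the coordinates by `p.2` and translating by `p.1`. -/
def cubeSymmetry (p : Fin 8 × Equiv.Perm (Fin 3)) (i : Fin 8) : Fin 8 :=
  p.1 ^^^ Fin.ofNat 8 (∑ k : Fin 3, ((i : ℕ).testBit k).toNat * 2 ^ (p.2 k : ℕ))

theorem cubeSymmetry_injective : ∀ p, Function.Injective (cubeSymmetry p) := by
  decide +kernel

theorem cubeSymmetry_adj : ∀ p i j,
    cubeGraph.Adj (cubeSymmetry p i) (cubeSymmetry p j) ↔ cubeGraph.Adj i j := by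
  decide +kernel

theorem cubeSymmetry_faithful : ∀ p p', (∀ i, cubeSymmetry p i = cubeSymmetry p' i) → p = p' := by
  decide +kernel

theorem cubeGraph_connected : cubeGraph.Connected := by
  have hdown : ∀ i : Fin 8, i ≠ 0 → ∃ j < i, cubeGraph.Adj j i := by decide +kernel
  have hreach : ∀ i : Fin 8, cubeGraph.Reachable 0 i := fun i => by
    induction i using WellFoundedLT.induction with
    | ind i ih =>
      by_cases hi : i = 0
      · rw [hi]
      · obtain ⟨j, hj, hadj⟩ := hdown i hi
        exact (ih j hj).trans hadj.reachable
  exact ⟨fun i j => (hreach i).symm.trans (hreach j)⟩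

theorem cubeGraph_ncard_neighborSet (v : Fin 8) : (cubeGraph.neighborSet v).ncard = 3 := by
  rw [Set.ncard_eq_toFinset_card']
  revert v
  decide +kernel

theorem le_card_aut_cubeGraph : 48 ≤ Nat.card (cubeGraph ≃g cubeGraph) := by
  let F : Fin 8 × Equiv.Perm (Fin 3) → (cubeGraph ≃g cubeGraph) := fun p =>
    { toEquiv := Equiv.ofBijective _ (Finite.injective_iff_bijective.1 (cubeSymmetry_injective p))
      map_rel_iff' := cubeSymmetry_adj p _ _ }
  have hF : Function.Injective F := fun p p' h =>
    cubeSymmetry_faithful p p' fun i => DFunLike.congr_fun h i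
  have : Finite (cubeGraph ≃g cubeGraph) := DFunLike.finite _
  calc 48 = Nat.card (Fin 8 × Equiv.Perm (Fin 3)) := by
        simp [Fintype.card_perm, Nat.factorial]
    _ ≤ _ := Nat.card_le_card_of_injective F hF

theorem cubic_eight_vertices_aut_bound :
    (∀ (V : Type) [Fintype V], Fintype.card V = 8 →
      ∀ G : SimpleGraph V, G.Connected → (∀ v : V, (G.neighborSet v).ncard = 3) →
        Nat.card (G ≃g G) ≤ 48) ∧
    (∃ G : SimpleGraph (Fin 8), G.Connected ∧
      (∀ v : Fin 8, (G.neighborSet v).ncard = 3) ∧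
      Nat.card (G ≃g G) = 48) := by
  have hle : ∀ (V : Type) [Fintype V], Fintype.card V = 8 →
      ∀ G : SimpleGraph V, G.Connected → (∀ v : V, (G.neighborSet v).ncard = 3) →
        Nat.card (G ≃g G) ≤ 48 := fun V _ hV G hconn hG => by
    obtain ⟨e, h0, hsort⟩ := exists_labelling hV G hG
    exact card_aut_le_of_labelling hconn hG e h0 hsort
  exact ⟨hle, cubeGraph, cubeGraph_connected, cubeGraph_ncard_neighborSet,
    (hle _ (Fintype.card_fin 8) _ cubeGraph_connected cubeGraph_ncard_neighborSet).antisymm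
      le_card_aut_cubeGraph⟩
end

section
/- Every finite connected cubic simple graph on 10 vertices has at most 120 automorphisms, and this bound is attained by some connected cubic simple graph on 10 vertices (the Petersen graph). -/
namespace SimpleGraph

section Automorphisms

variable {V : Type*} {G : SimpleGraph V}

theorem exists_third_neighbor {v p q : V} (hv : (G.neighborSet v).ncard = 3) (hp : G.Adj v p)
    (hq : G.Adj v q) (hpq : p ≠ q) :
    ∃ r, r ≠ p ∧ r ≠ q ∧ ∀ x, G.Adj v x ↔ x = p ∨ x = q ∨ x = r := by
  obtain ⟨x, y, z, hxy, hxz, hyz, h⟩ := Set.ncard_eq_three.mp hv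
  have h' : ∀ w, G.Adj v w ↔ w = x ∨ w = y ∨ w = z := fun w => by
    rw [← mem_neighborSet, h]; simp
  have hp' := (h' p).1 hp
  have hq' := (h' q).1 hq
  simp only [h']
  rcases hp' with rfl | rfl | rfl <;> rcases hq' with rfl | rfl | rfl
  all_goals first
    | exact absurd rfl hpq
    | exact ⟨x, by grind⟩
    | exact ⟨y, by grind⟩
    | exact ⟨z, by grind⟩

theorem adj_iff_of_three {s p q r : V} (hs : (G.neighborSet s).ncard = 3) (hp : G.Adj s p)
    (hq : G.Adj s q) (hr : G.Adj s r) (hpq : p ≠ q) (hpr : p ≠ r) (hqr : q ≠ r) (x : V) :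
    G.Adj s x ↔ x = p ∨ x = q ∨ x = r := by
  obtain ⟨t, -, -, ht⟩ := exists_third_neighbor hs hp hq hpq
  rcases (ht r).1 hr with rfl | rfl | rfl
  · exact absurd rfl hpr
  · exact absurd rfl hqr
  · exact ht x

theorem Iso.eq_of_common_neighbor {σ τ : G ≃g G} {s t v : V} (hs : σ s = τ s) (ht : σ t = τ t)
    (hsv : G.Adj s v) (htv : G.Adj t v)
    (h : ∀ w, G.Adj s w → G.Adj t w → σ w = τ w ∨ w = v) : σ v = τ v := by
  have h1 : G.Adj s (τ.symm (σ v)) := by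
    rw [← τ.map_adj_iff, ← hs]
    simpa [σ.map_adj_iff]
  have h2 : G.Adj t (τ.symm (σ v)) := by
    rw [← τ.map_adj_iff, ← ht]
    simpa [σ.map_adj_iff]
  rcases h _ h1 h2 with h3 | h3
  · rw [RelIso.apply_symm_apply] at h3
    have h4 := σ.injective h3
    rwa [RelIso.symm_apply_eq] at h4
  · rwa [RelIso.symm_apply_eq] at h3

theorem Iso.eq_of_third_neighbor {σ τ : G ≃g G} {s p q r : V}
    (hN : ∀ x, G.Adj s x ↔ x = p ∨ x = q ∨ x = r)
    (hs : σ s = τ s) (hp : σ p = τ p) (hq : σ q = τ q) : σ r = τ r := by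
  have hr : G.Adj s r := by simp [hN]
  refine Iso.eq_of_common_neighbor hs hs hr hr fun w hw _ => ?_
  rcases (hN w).1 hw with rfl | rfl | rfl <;> simp [hp, hq]

variable [Fintype V]

/-- The automorphisms of `G` that fix every vertex of `S`. -/
def fixing (G : SimpleGraph V) (S : Finset V) : Set (G ≃g G) := {σ | ∀ x ∈ S, σ x = x}

theorem finite_aut (G : SimpleGraph V) : Finite (G ≃g G) :=
  Finite.of_injective (fun σ : G ≃g G => (σ : V → V)) DFunLike.coe_injective

theorem ncard_fixing_le_mul {β : Type*} {S S' : Finset V} (T : Finset β) (f : G ≃g G → β)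
    (hT : ∀ σ ∈ fixing G S, f σ ∈ T)
    (hf : ∀ σ ∈ fixing G S, ∀ τ ∈ fixing G S, f σ = f τ → ∀ x ∈ S', σ x = τ x) :
    (fixing G S).ncard ≤ T.card * (fixing G S').ncard := by
  classical
  have := finite_aut G
  have := Fintype.ofFinite (G ≃g G)
  rw [Set.ncard_eq_toFinset_card' (fixing G S), mul_comm]
  refine Finset.card_le_mul_card_image_of_maps_to (f := f) (by simpa using hT) _ fun b _ => ?_
  rw [← Set.ncard_coe_finset]
  rcases Set.eq_empty_or_nonempty
    (↑({a ∈ (fixing G S).toFinset | f a = b} : Finset (G ≃g G)) : Set (G ≃g G)) with h | ⟨τ, hτ⟩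
  · rw [h]; simp
  · simp only [Finset.coe_filter, Set.mem_toFinset, Set.mem_ofPred_eq] at hτ ⊢
    refine Set.ncard_le_ncard_of_injOn (fun σ => σ.trans τ.symm) ?_ ?_ (Set.toFinite _)
    · rintro σ ⟨hσ, hb⟩ x hx
      simp [hf σ hσ τ hτ.1 (hb.trans hτ.2.symm) x hx]
    · intro σ _ σ' _ h
      ext x
      simpa using congrArg (fun ρ : G ≃g G => ρ x) h

/-- If the images of a vertex `a` and of some further data under an automorphism determine the
images of all vertices in `S`, then counting these images bounds the automorphism group. -/
theorem card_aut_le_mul {β : Type*} {S : Finset V} {n : ℕ} (P : V → Finset β)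
    (hP : ∀ v, (P v).card ≤ n) (a : V) (f : G ≃g G → β) (hf : ∀ σ, f σ ∈ P (σ a))
    (hfS : ∀ σ τ : G ≃g G, σ a = τ a → f σ = f τ → ∀ x ∈ S, σ x = τ x) :
    Nat.card (G ≃g G) ≤ Fintype.card V * n * (fixing G S).ncard := by
  have h := ncard_fixing_le_mul (G := G) (S := ∅) (S' := S) (Finset.univ.sigma P)
    (fun σ => ⟨σ a, f σ⟩) (fun σ _ => by simpa using hf σ)
    (fun σ _ τ _ h => by
      simp only [Sigma.mk.injEq, heq_eq_eq] at h
      exact hfS σ τ h.1 h.2)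
  have h0 : fixing G ∅ = Set.univ := by simp [fixing]
  rw [h0, Set.ncard_univ] at h
  refine h.trans (Nat.mul_le_mul_right _ ?_)
  rw [Finset.card_sigma]
  simpa using Finset.sum_le_card_nsmul Finset.univ _ n fun v _ => hP v

theorem ncard_fixing_univ_le : (fixing G Finset.univ).ncard ≤ 1 := by
  have := finite_aut G
  rw [Set.ncard_le_one]
  intro σ hσ τ hτ
  ext x
  rw [hσ x (Finset.mem_univ x), hτ x (Finset.mem_univ x)]

theorem Connected.exists_adj_notMem (hc : G.Connected) {S : Finset V} (hS : S.Nonempty)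
    (hS' : S ≠ Finset.univ) : ∃ s ∈ S, ∃ t ∉ S, G.Adj s t := by
  obtain ⟨u, hu⟩ := hS
  obtain ⟨v, hv⟩ : ∃ v, v ∉ S := by simpa [Finset.eq_univ_iff_forall] using hS'
  obtain ⟨p⟩ := hc.preconnected u v
  obtain ⟨d, -, h1, h2⟩ := p.exists_boundary_dart (S : Set V) hu hv
  exact ⟨d.fst, h1, d.snd, h2, d.adj⟩

/-- A nonempty vertex set closed under adjacency is everything. -/
theorem Connected.eq_univ_of_closed (hc : G.Connected) {S : Finset V} (hS : S.Nonempty)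
    (h : ∀ s ∈ S, ∀ t, G.Adj s t → t ∈ S) : S = Finset.univ := by
  by_contra hS'
  obtain ⟨s, hs, t, ht, hst⟩ := hc.exists_adj_notMem hS hS'
  exact ht (h s hs t hst)

theorem ncard_fixing_le_two_pow (hc : G.Connected) (h3 : ∀ v, (G.neighborSet v).ncard = 3)
    {S : Finset V} (hS : S.Nonempty) (hadj : ∀ s ∈ S, ∃ p ∈ S, G.Adj s p) :
    (fixing G S).ncard ≤ 2 ^ ((Fintype.card V - S.card) / 2) := by
  classical
  induction hn : Fintype.card V - S.card using Nat.strong_induction_on generalizing S with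
  | _ n ih =>
  by_cases hu : S = Finset.univ
  · subst hu
    exact ncard_fixing_univ_le.trans Nat.one_le_two_pow
  obtain ⟨s, hs, t, ht, hst⟩ := hc.exists_adj_notMem hS hu
  obtain ⟨p, hp, hsp⟩ := hadj s hs
  obtain ⟨t', htp, htt, hN⟩ := exists_third_neighbor (h3 s) hsp hst
    (by rintro rfl; exact ht hp)
  have hle : (insert t (insert t' S)).card ≤ Fintype.card V := Finset.card_le_univ _
  have hst' : G.Adj s t' := by simp [hN]
  have hagree : ∀ {σ τ : G ≃g G}, σ ∈ fixing G S → τ ∈ fixing G S → ∀ x ∈ S, σ x = τ x :=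
    fun hσ hτ x hx => (hσ x hx).trans (hτ x hx).symm
  have ih' := ih _ ?_ (S := insert t (insert t' S)) (by simp) ?_ rfl
  · clear ih
    by_cases ht' : t' ∈ S
    · rw [Finset.insert_eq_of_mem ht', Finset.card_insert_of_notMem ht] at ih'
      have := ncard_fixing_le_mul (G := G) (S := S) (S' := insert t S) {()} (fun _ => ())
        (by simp) (by
          intro σ hσ τ hτ _
          have h := hagree hσ hτ
          refine (Finset.forall_mem_insert _ _ _).2 ⟨?_, h⟩
          exact Iso.eq_of_third_neighbor (s := s) (p := p) (q := t')
            (fun x => (hN x).trans (by tauto)) (h s hs) (h p hp) (h t' ht'))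
      rw [Finset.card_singleton, one_mul] at this
      refine this.trans (ih'.trans (Nat.pow_le_pow_right (by norm_num) ?_))
      omega
    · have hcard : (insert t (insert t' S)).card = S.card + 2 := by
        rw [Finset.card_insert_of_notMem (by simp [ht, htt.symm]),
          Finset.card_insert_of_notMem ht']
      have := ncard_fixing_le_mul (G := G) (S := S) (S' := insert t (insert t' S)) {t, t'}
        (fun σ => σ t) (by
          intro σ hσ
          have h1 : G.Adj s (σ t) := by
            rw [← hσ s hs]
            simpa [σ.map_adj_iff]
          rcases (hN _).1 h1 with h2 | h2 | h2
          · rw [← hσ p hp] at h2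
            exact absurd hp (σ.injective h2 ▸ ht)
          all_goals simp [h2]) (by
          intro σ hσ τ hτ ht
          have h := hagree hσ hτ
          refine (Finset.forall_mem_insert _ _ _).2
            ⟨ht, (Finset.forall_mem_insert _ _ _).2 ⟨?_, h⟩⟩
          exact Iso.eq_of_third_neighbor hN (h s hs) (h p hp) ht)
      rw [Finset.card_pair htt.symm] at this
      refine this.trans ((Nat.mul_le_mul_left 2 ih').trans ?_)
      rw [← pow_succ']
      refine Nat.pow_le_pow_right (by norm_num) ?_
      omega
  · have := Finset.card_lt_card (Finset.ssubset_insert (a := t) (s := S) ht)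
    have := Finset.card_le_card (Finset.insert_subset_insert t (Finset.subset_insert t' S))
    omega
  · simp only [Finset.mem_insert]
    rintro x (rfl | rfl | hx)
    · exact ⟨s, by simp [hs], hst.symm⟩
    · exact ⟨s, by simp [hs], hst'.symm⟩
    · obtain ⟨y, hy, h⟩ := hadj x hx
      exact ⟨y, by simp [hy], h⟩

theorem _root_.Finset.card_le_two_of_swap {α : Type*} [DecidableEq α] {s : Finset (α × α)}
    (h : ∀ p ∈ s, ∀ q ∈ s, q = p ∨ q = p.swap) : s.card ≤ 2 := by
  rcases s.eq_empty_or_nonempty with rfl | ⟨p, hp⟩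
  · simp
  · exact (Finset.card_le_card (t := {p, p.swap}) fun q hq => by simpa using h p hp q hq).trans
      Finset.card_le_two

theorem card_neighborFinset_of_ncard [DecidableRel G.Adj] {n : ℕ}
    (h3 : ∀ v, (G.neighborSet v).ncard = n) (v : V) : (G.neighborFinset v).card = n := by
  rw [← h3 v, Set.ncard_eq_toFinset_card']
  rfl

theorem card_aut_le_of_diamond (hV : Fintype.card V = 10) (hc : G.Connected)
    (h3 : ∀ v, (G.neighborSet v).ncard = 3) {a b c d : V} (hba : G.Adj b a) (hbc : G.Adj b c)
    (hbd : G.Adj b d) (hca : G.Adj c a) (hcd : G.Adj c d) (had : a ≠ d) :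
    Nat.card (G ≃g G) ≤ 120 := by
  classical
  have hs : ∀ x y, G.Adj x y → G.Adj y x := fun _ _ h => h.symm
  have hi : ∀ x, ¬ G.Adj x x := G.loopless.irrefl
  have hNb := adj_iff_of_three (h3 b) hba hbd hbc had hca.ne' hcd.ne'
  have hNc := adj_iff_of_three (h3 c) hca hcd hbc.symm had hba.ne' hbd.ne'
  have hnad : ¬ G.Adj a d := by
    intro h
    have hNa := adj_iff_of_three (h3 a) hba.symm hca.symm h hbc.ne hbd.ne hcd.ne
    have hNd := adj_iff_of_three (h3 d) hbd.symm hcd.symm h.symm hbc.ne hba.ne hca.ne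
    have h1 := hc.eq_univ_of_closed (S := {a, b, c, d}) (by simp) (by
      simp only [Finset.mem_insert, Finset.mem_singleton]
      grind)
    have h2 : ({a, b, c, d} : Finset V).card ≤ 4 := Finset.card_le_four
    rw [h1, Finset.card_univ] at h2
    omega
  obtain ⟨a', hab', hac', hNa⟩ := exists_third_neighbor (h3 a) hba.symm hca.symm hbc.ne
  obtain ⟨d', hdb', hdc', hNd⟩ := exists_third_neighbor (h3 d) hbd.symm hcd.symm hbc.ne
  have haa' : G.Adj a a' := by simp [hNa]
  have hdd' : G.Adj d d' := by simp [hNd]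
  have key : ∀ S : Finset V, S.card = 6 → (∀ s ∈ S, ∃ p ∈ S, G.Adj s p) →
      (∀ σ τ : G ≃g G, σ a = τ a → σ b = τ b → σ c = τ c → σ d = τ d → ∀ x ∈ S, σ x = τ x) →
      Nat.card (G ≃g G) ≤ 120 := by
    intro S hS hS' hag
    have h1 := card_aut_le_mul (G := G) (S := S) (n := 2)
      (fun v => {p ∈ (G.neighborFinset v).offDiag |
        ¬ G.Adj p.1 p.2 ∧ ∃ r, G.Adj v r ∧ G.Adj r p.1 ∧ G.Adj r p.2}) ?_ b
      (fun σ => (σ a, σ d)) ?_ ?_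
    · have h2 := ncard_fixing_le_two_pow hc h3 (Finset.card_pos.1 (by omega)) hS'
      rw [hV, hS] at h2
      rw [hV] at h1
      norm_num at h2
      omega
    · refine fun v => Finset.card_le_two_of_swap ?_
      rintro ⟨p, q⟩ h ⟨p', q'⟩ h'
      simp only [Finset.mem_filter, Finset.mem_offDiag, mem_neighborFinset] at h h'
      obtain ⟨⟨hp, hq, hpq⟩, hnpq, r, hr, hrp, hrq⟩ := h
      obtain ⟨⟨hp', hq', hpq'⟩, hnpq', -⟩ := h'
      have hNv := adj_iff_of_three (h3 v) hp hq hr hpq hrp.ne' hrq.ne'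
      rw [hNv] at hp' hq'
      simp only [Prod.swap_prod_mk, Prod.mk.injEq]
      grind
    · intro σ
      simp only [Finset.mem_filter, Finset.mem_offDiag, mem_neighborFinset, σ.map_adj_iff]
      exact ⟨⟨hba, hbd, fun h => had (σ.injective h)⟩, hnad, σ c, by simp [σ.map_adj_iff, *]⟩
    · intro σ τ hb h
      obtain ⟨ha, hd⟩ := Prod.mk.inj h
      exact hag σ τ ha hb (Iso.eq_of_third_neighbor hNb hb ha hd) hd
  by_cases had' : a' = d'
  · subst had'
    obtain ⟨e, hea, hed, hNe⟩ := exists_third_neighbor (h3 a') haa'.symm hdd'.symm had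
    have ha'e : G.Adj a' e := by simp [hNe]
    refine key {a, b, c, d, a', e} ?_ ?_ ?_
    · grind
    · simp only [Finset.mem_insert, Finset.mem_singleton]
      grind
    · intro σ τ ha hb hc hd
      have ha' := Iso.eq_of_third_neighbor hNa ha hb hc
      have he := Iso.eq_of_third_neighbor hNe ha' ha hd
      simp [*]
  · refine key {a, b, c, d, a', d'} ?_ ?_ ?_
    · grind
    · simp only [Finset.mem_insert, Finset.mem_singleton]
      grind
    · intro σ τ ha hb hc hd
      have ha' := Iso.eq_of_third_neighbor hNa ha hb hc
      have hd' := Iso.eq_of_third_neighbor hNd hd hb hc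
      simp [*]

theorem card_aut_le_of_triangle (hV : Fintype.card V = 10) (hc : G.Connected)
    (h3 : ∀ v, (G.neighborSet v).ncard = 3) {a b c : V} (hab : G.Adj a b) (hbc : G.Adj b c)
    (hac : G.Adj a c) : Nat.card (G ≃g G) ≤ 120 := by
  classical
  by_cases hd : ∃ a b c d, G.Adj b a ∧ G.Adj b c ∧ G.Adj b d ∧ G.Adj c a ∧ G.Adj c d ∧ a ≠ d
  · obtain ⟨a, b, c, d, h1, h2, h3', h4, h5, h6⟩ := hd
    exact card_aut_le_of_diamond hV hc h3 h1 h2 h3' h4 h5 h6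
  replace hd : ∀ a b c d, G.Adj b a → G.Adj b c → G.Adj b d → G.Adj c a → G.Adj c d → a = d := by
    intro a b c d h1 h2 h3 h4 h5
    by_contra h
    exact hd ⟨a, b, c, d, h1, h2, h3, h4, h5, h⟩
  have hs : ∀ x y, G.Adj x y → G.Adj y x := fun _ _ h => h.symm
  have hi : ∀ x, ¬ G.Adj x x := G.loopless.irrefl
  obtain ⟨a', hab', hac', hNa⟩ := exists_third_neighbor (h3 a) hab hac hbc.ne
  obtain ⟨b', hba', hbc', hNb⟩ := exists_third_neighbor (h3 b) hab.symm hbc hac.ne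
  obtain ⟨c', hca', hcb', hNc⟩ := exists_third_neighbor (h3 c) hac.symm hbc.symm hab.ne
  have haa' : G.Adj a a' := by simp [hNa]
  have hbb' : G.Adj b b' := by simp [hNb]
  have hcc' : G.Adj c c' := by simp [hNc]
  have h1 : a' ≠ b' := by
    rintro rfl
    exact hac' (hd _ _ _ _ haa' hab hac hbb' hbc)
  have h2 : a' ≠ c' := by
    rintro rfl
    exact hab' (hd _ _ _ _ haa' hac hab hcc' hbc.symm)
  have h4 : b' ≠ c' := by
    rintro rfl
    exact hba' (hd _ _ _ _ hbb' hbc hab.symm hcc' hac.symm)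
  have hcard : ({a, b, c, a', b', c'} : Finset V).card = 6 := by
    have := hab.ne
    have := hbc.ne
    have := hac.ne
    have := haa'.ne
    have := hbb'.ne
    have := hcc'.ne
    clear hNa hNb hNc hd h3
    grind
  have h5 := card_aut_le_mul (G := G) (S := {a, b, c, a', b', c'}) (n := 2)
    (fun v => {p ∈ (G.neighborFinset v).offDiag | G.Adj p.1 p.2}) ?_ a (fun σ => (σ b, σ c)) ?_ ?_
  · have h6 := ncard_fixing_le_two_pow hc h3 (S := {a, b, c, a', b', c'}) (by simp) (by
      simp only [Finset.mem_insert, Finset.mem_singleton]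
      grind)
    rw [hV, hcard] at h6
    rw [hV] at h5
    norm_num at h6
    omega
  · refine fun v => Finset.card_le_two_of_swap ?_
    rintro ⟨p, q⟩ h ⟨p', q'⟩ h'
    simp only [Finset.mem_filter, Finset.mem_offDiag, mem_neighborFinset] at h h'
    obtain ⟨⟨hp, hq, hpq⟩, hpqa⟩ := h
    obtain ⟨⟨hp', hq', hpq'⟩, hpqa'⟩ := h'
    obtain ⟨r, hrp, hrq, hNv⟩ := exists_third_neighbor (h3 v) hp hq hpq
    have hr : G.Adj v r := by simp [hNv]
    have h1 := hd r v p q hr hp hq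
    have h2 := hd r v q p hr hq hp
    rw [hNv] at hp' hq'
    simp only [Prod.swap_prod_mk, Prod.mk.injEq]
    grind
  · intro σ
    simp [σ.map_adj_iff, *, hbc.ne]
  · intro σ τ ha h
    obtain ⟨hb, hc⟩ := Prod.mk.inj h
    have ha' := Iso.eq_of_third_neighbor hNa ha hb hc
    have hb' := Iso.eq_of_third_neighbor hNb hb ha hc
    have hc' := Iso.eq_of_third_neighbor hNc hc ha hb
    simp [*]

theorem card_aut_le_of_four_cycle_aux (hV : Fintype.card V = 10) (hc : G.Connected)
    (h3 : ∀ v, (G.neighborSet v).ncard = 3)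
    (ht : ∀ a b c, G.Adj a b → G.Adj b c → ¬ G.Adj a c) {a b c d b' d' : V} (hac : a ≠ c)
    (hbd : b ≠ d) (hNb : ∀ x, G.Adj b x ↔ x = a ∨ x = c ∨ x = b') (hb'a : b' ≠ a) (hb'c : b' ≠ c)
    (hNd : ∀ x, G.Adj d x ↔ x = a ∨ x = c ∨ x = d') (hd'a : d' ≠ a) (hd'c : d' ≠ c)
    (hbd' : b' ≠ d') : Nat.card (G ≃g G) ≤ 120 := by
  classical
  have hs : ∀ x y, G.Adj x y → G.Adj y x := fun _ _ h => h.symm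
  have hi : ∀ x, ¬ G.Adj x x := G.loopless.irrefl
  have hba : G.Adj b a := by simp [hNb]
  have hbc : G.Adj b c := by simp [hNb]
  have hbb' : G.Adj b b' := by simp [hNb]
  have hda : G.Adj d a := by simp [hNd]
  have hdc : G.Adj d c := by simp [hNd]
  have hdd' : G.Adj d d' := by simp [hNd]
  obtain ⟨a', ha'b, ha'd, hNa⟩ := exists_third_neighbor (h3 a) hba.symm hda.symm hbd
  have haa' : G.Adj a a' := by simp [hNa]
  have hcard : ({a, b, c, d, a', b', d'} : Finset V).card = 7 := by
    have := hba.ne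
    have := hbc.ne
    have := hda.ne
    have := hdc.ne
    have := haa'.ne
    have := hbb'.ne
    have := hdd'.ne
    have : a' ≠ b' := by
      rintro rfl
      exact ht _ _ _ hba haa' hbb'
    have : a' ≠ d' := by
      rintro rfl
      exact ht _ _ _ hda haa' hdd'
    have : a' ≠ c := by
      rintro rfl
      exact ht _ _ _ hba haa' hbc
    have : b' ≠ d := by
      rintro rfl
      exact ht _ _ _ hbb' hda hba
    have : d' ≠ b := by
      rintro rfl
      exact ht _ _ _ hdd' hba hda
    clear hNa hNb hNd ht h3
    grind
  have h5 := card_aut_le_mul (G := G) (S := {a, b, c, d, a', b', d'}) (n := 6)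
    (fun v => (G.neighborFinset v).offDiag) ?_ a (fun σ => (σ b, σ d)) ?_ ?_
  · have h6 := ncard_fixing_le_two_pow hc h3 (S := {a, b, c, d, a', b', d'}) (by simp) (by
      simp only [Finset.mem_insert, Finset.mem_singleton]
      grind)
    rw [hV, hcard] at h6
    rw [hV] at h5
    norm_num at h6
    omega
  · intro v
    rw [Finset.offDiag_card, card_neighborFinset_of_ncard h3]
  · intro σ
    simp [σ.map_adj_iff, hba.symm, hda.symm, hbd]
  · intro σ τ ha h
    obtain ⟨hb, hd⟩ := Prod.mk.inj h
    have ha' := Iso.eq_of_third_neighbor hNa ha hb hd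
    have hc := Iso.eq_of_common_neighbor (σ := σ) (τ := τ) hb hd hbc hdc (by grind)
    have hb' := Iso.eq_of_third_neighbor hNb hb ha hc
    have hd' := Iso.eq_of_third_neighbor hNd hd ha hc
    simp [*]

theorem card_aut_le_of_four_cycle (hV : Fintype.card V = 10) (hc : G.Connected)
    (h3 : ∀ v, (G.neighborSet v).ncard = 3)
    (ht : ∀ a b c, G.Adj a b → G.Adj b c → ¬ G.Adj a c) {a b c d : V} (hab : G.Adj a b)
    (hbc : G.Adj b c) (hcd : G.Adj c d) (hda : G.Adj d a) (hac : a ≠ c) (hbd : b ≠ d) :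
    Nat.card (G ≃g G) ≤ 120 := by
  classical
  obtain ⟨a', ha'b, ha'd, hNa⟩ := exists_third_neighbor (h3 a) hab hda.symm hbd
  obtain ⟨b', hb'a, hb'c, hNb⟩ := exists_third_neighbor (h3 b) hab.symm hbc hac
  obtain ⟨c', hc'b, hc'd, hNc⟩ := exists_third_neighbor (h3 c) hbc.symm hcd hbd
  obtain ⟨d', hd'a, hd'c, hNd⟩ := exists_third_neighbor (h3 d) hda hcd.symm hac
  by_cases h1 : b' = d'
  swap
  · exact card_aut_le_of_four_cycle_aux hV hc h3 ht hac hbd hNb hb'a hb'c hNd hd'a hd'c h1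
  by_cases h2 : a' = c'
  swap
  · exact card_aut_le_of_four_cycle_aux hV hc h3 ht hbd hac hNa ha'b ha'd hNc hc'b hc'd h2
  subst h1 h2
  have haa' : G.Adj a' a := ((hNa _).2 (by simp)).symm
  have hca' : G.Adj a' c := ((hNc _).2 (by simp)).symm
  have hbb' : G.Adj b' b := ((hNb _).2 (by simp)).symm
  have hdb' : G.Adj b' d := ((hNd _).2 (by simp)).symm
  obtain ⟨e, hea, hec, hNa'⟩ := exists_third_neighbor (h3 a') haa' hca' hac
  by_cases h4 : b' = e
  swap
  · exact card_aut_le_of_four_cycle_aux hV hc h3 ht hac ha'b.symm hNb hb'a hb'c hNa' hea hec h4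
  subst h4
  have hb'a' : G.Adj b' a' := ((hNa' _).2 (by simp)).symm
  have hNb' := adj_iff_of_three (h3 b') hbb' hdb' hb'a' hbd ha'b.symm ha'd.symm
  have h5 := hc.eq_univ_of_closed (S := {a, b, c, d, a', b'}) (by simp) (by
    simp only [Finset.mem_insert, Finset.mem_singleton]
    grind)
  have h6 : ({a, b, c, d, a', b'} : Finset V).card ≤ 6 := Finset.card_le_six
  rw [h5, Finset.card_univ] at h6
  omega

/-- In a cubic graph on ten vertices without triangles and four-cycles, any two distinct
nonadjacent vertices have a common neighbor. -/
theorem exists_common_neighbor (hV : Fintype.card V = 10) (h3 : ∀ v, (G.neighborSet v).ncard = 3)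
    (ht : ∀ a b c, G.Adj a b → G.Adj b c → ¬ G.Adj a c)
    (hu : ∀ a b c d, a ≠ c → G.Adj a b → G.Adj b c → G.Adj a d → G.Adj d c → b = d) {v w : V}
    (hvw : v ≠ w) (hnvw : ¬ G.Adj v w) : ∃ p, G.Adj v p ∧ G.Adj p w := by
  classical
  set B := (G.neighborFinset v).biUnion fun p => (G.neighborFinset p).erase v with hB
  have hcardB : B.card = 6 := by
    rw [hB, Finset.card_biUnion]
    · rw [Finset.sum_congr rfl (g := fun _ => 2)]
      · simp [card_neighborFinset_of_ncard h3]
      · intro p hp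
        rw [mem_neighborFinset] at hp
        rw [Finset.card_erase_of_mem (by simpa using hp.symm), card_neighborFinset_of_ncard h3]
    · intro p hp q hq hpq
      rw [Finset.mem_coe, mem_neighborFinset] at hp hq
      refine Finset.disjoint_left.2 fun x hx hx' => hpq ?_
      simp only [Finset.mem_erase, mem_neighborFinset] at hx hx'
      exact hu _ _ _ _ hx.1.symm hp hx.2 hq hx'.2
  have hdisj : Disjoint B (insert v (G.neighborFinset v)) := by
    refine Finset.disjoint_left.2 fun x hx hx' => ?_
    simp only [hB, Finset.mem_biUnion, Finset.mem_erase, mem_neighborFinset] at hx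
    obtain ⟨p, hp, hxv, hpx⟩ := hx
    rcases Finset.mem_insert.1 hx' with h | h
    · exact hxv h
    · exact ht _ _ _ hp hpx (by simpa using h)
  have huniv : B ∪ insert v (G.neighborFinset v) = Finset.univ := by
    rw [← Finset.card_eq_iff_eq_univ, Finset.card_union_of_disjoint hdisj, hcardB,
      Finset.card_insert_of_notMem (by simp), card_neighborFinset_of_ncard h3, hV]
  have hw := Finset.mem_univ w
  simp only [← huniv, hB, Finset.mem_union, Finset.mem_biUnion, Finset.mem_erase,
    mem_neighborFinset, Finset.mem_insert] at hw
  rcases hw with ⟨p, hp, -, hpw⟩ | h | h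
  · exact ⟨p, hp, hpw⟩
  · exact absurd h.symm hvw
  · exact absurd h hnvw

theorem card_aut_le_of_girth (hV : Fintype.card V = 10) (h3 : ∀ v, (G.neighborSet v).ncard = 3)
    (ht : ∀ a b c, G.Adj a b → G.Adj b c → ¬ G.Adj a c)
    (hu : ∀ a b c d, a ≠ c → G.Adj a b → G.Adj b c → G.Adj a d → G.Adj d c → b = d) :
    Nat.card (G ≃g G) ≤ 120 := by
  classical
  obtain ⟨v⟩ : Nonempty V := Fintype.card_pos_iff.1 (by omega)
  obtain ⟨x, y, z, hxy, hxz, hyz, hN⟩ := Set.ncard_eq_three.mp (h3 v)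
  have hNv : ∀ w, G.Adj v w ↔ w = x ∨ w = y ∨ w = z := fun w => by
    rw [← mem_neighborSet, hN]; simp
  have hvx : G.Adj v x := by simp [hNv]
  have hvy : G.Adj v y := by simp [hNv]
  have hvz : G.Adj v z := by simp [hNv]
  obtain ⟨p, q, hpv, hqv, hNx⟩ : ∃ p q, p ≠ v ∧ q ≠ v ∧ ∀ w, G.Adj x w ↔ w = v ∨ w = p ∨ w = q := by
    obtain ⟨p, hp, hpv⟩ := Set.exists_ne_of_one_lt_ncard (s := G.neighborSet x) (by simp [h3]) v
    obtain ⟨q, hq, -, h⟩ := exists_third_neighbor (h3 x) hvx.symm hp hpv.symm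
    exact ⟨p, q, hpv, hq, h⟩
  have hxp : G.Adj x p := by simp [hNx]
  have h5 := card_aut_le_mul (G := G) (S := Finset.univ) (n := 12)
    (fun v => (G.neighborFinset v).offDiag.sigma fun e => (G.neighborFinset e.1).erase v) ?_ v
    (fun σ => ⟨(σ x, σ y), σ p⟩) ?_ ?_
  · have h6 := ncard_fixing_univ_le (G := G)
    rw [hV] at h5
    omega
  · intro v
    rw [Finset.card_sigma, Finset.sum_congr rfl (g := fun _ => 2)]
    · simp [Finset.offDiag_card, card_neighborFinset_of_ncard h3]
    · intro e he
      simp only [Finset.mem_offDiag, mem_neighborFinset] at he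
      rw [Finset.card_erase_of_mem (by simpa using he.1.symm), card_neighborFinset_of_ncard h3]
  · intro σ
    simp [σ.map_adj_iff, hvx, hvy, hxy, hxp, hpv]
  · intro σ τ hv h
    simp only [Sigma.mk.injEq, Prod.mk.injEq, heq_eq_eq] at h
    obtain ⟨⟨hx, hy⟩, hp⟩ := h
    have hz := Iso.eq_of_third_neighbor hNv hv hx hy
    have hq := Iso.eq_of_third_neighbor hNx hx hv hp
    have far : ∀ y w, G.Adj v y → y ≠ x → σ y = τ y → G.Adj y w → w ≠ v → σ w = τ w := by
      intro y w hvy hyx hy hyw hwv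
      have hxw : x ≠ w := by
        rintro rfl
        exact ht _ _ _ hvy hyw hvx
      have hnxw : ¬ G.Adj x w := fun h => hyx (hu _ _ _ _ hwv.symm hvy hyw hvx h)
      obtain ⟨s, hxs, hsw⟩ := exists_common_neighbor hV h3 ht hu hxw hnxw
      have hs : σ s = τ s := by
        rcases (hNx s).1 hxs with rfl | rfl | rfl <;> assumption
      refine Iso.eq_of_common_neighbor hs hy hsw hyw fun r hsr hyr => Or.inr ?_
      refine (hu s w y r ?_ hsw hyw.symm hsr hyr.symm).symm
      rintro rfl
      exact ht _ _ _ hvx hxs hvy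
    intro w _
    by_cases hwv : w = v
    · rw [hwv, hv]
    by_cases hvw : G.Adj v w
    · rcases (hNv w).1 hvw with rfl | rfl | rfl <;> assumption
    obtain ⟨s, hvs, hsw⟩ := exists_common_neighbor hV h3 ht hu (Ne.symm hwv) hvw
    rcases (hNv s).1 hvs with rfl | rfl | rfl
    · rcases (hNx w).1 hsw with rfl | rfl | rfl <;> assumption
    · exact far _ _ hvs hxy.symm hy hsw hwv
    · exact far _ _ hvs hxz.symm hz hsw hwv

/-- A connected cubic graph on ten vertices has at most 120 automorphisms. -/
theorem Connected.card_aut_le (hV : Fintype.card V = 10) (hc : G.Connected)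
    (h3 : ∀ v, (G.neighborSet v).ncard = 3) : Nat.card (G ≃g G) ≤ 120 := by
  by_cases ht : ∀ a b c, G.Adj a b → G.Adj b c → ¬ G.Adj a c
  · by_cases hu : ∀ a b c d, a ≠ c → G.Adj a b → G.Adj b c → G.Adj a d → G.Adj d c → b = d
    · exact card_aut_le_of_girth hV h3 ht hu
    · push Not at hu
      obtain ⟨a, b, c, d, hac, hab, hbc, had, hdc, hbd⟩ := hu
      exact card_aut_le_of_four_cycle hV hc h3 ht hab hbc hdc.symm had.symm hac hbd
  · push Not at ht
    obtain ⟨a, b, c, hab, hbc, hac⟩ := ht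
    exact card_aut_le_of_triangle hV hc h3 hab hbc hac

end Automorphisms

section Kneser

/-- The Kneser graph on the `k`-element subsets of `α`: adjacency is disjointness. -/
def kneser (α : Type*) [DecidableEq α] (k : ℕ) (hk : k ≠ 0) :
    SimpleGraph {s : Finset α // s.card = k} where
  Adj s t := Disjoint s.1 t.1
  symm := ⟨fun _ _ h => h.symm⟩
  loopless := ⟨fun s h => hk (by
    have h1 := s.2
    rwa [disjoint_self.1 h, Finset.bot_eq_empty, Finset.card_empty, eq_comm] at h1)⟩

variable {α : Type*} [DecidableEq α] {k : ℕ} {hk : k ≠ 0}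

instance : DecidableRel (kneser α k hk).Adj := fun s t =>
  inferInstanceAs (Decidable (Disjoint s.1 t.1))

/-- The automorphism of the Kneser graph induced by a permutation of the ground set. -/
def kneserAut (hk : k ≠ 0) (e : Equiv.Perm α) : kneser α k hk ≃g kneser α k hk where
  toEquiv := (Equiv.finsetCongr e).subtypeEquiv (by simp)
  map_rel_iff' := by simp [kneser]

theorem kneserAut_two_injective {n : ℕ} (hn : 3 ≤ n) :
    Function.Injective (kneserAut (α := Fin n) two_ne_zero) := by
  intro e e' h
  have hpair : ∀ i j : Fin n, i ≠ j → e i = e' i ∨ e i = e' j := by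
    intro i j hij
    have h1 := congrArg Subtype.val
      (congrArg (fun φ : kneser (Fin n) 2 two_ne_zero ≃g _ => φ ⟨{i, j}, Finset.card_pair hij⟩) h)
    have h2 : e i ∈ ({i, j} : Finset (Fin n)).map e.toEmbedding := by simp
    change ({i, j} : Finset (Fin n)).map e.toEmbedding = _ at h1
    rw [h1] at h2
    change e i ∈ ({i, j} : Finset (Fin n)).map e'.toEmbedding at h2
    simpa [eq_comm] using h2
  ext1 i
  obtain ⟨j, hj⟩ := Finset.exists_mem_notMem_of_card_lt_card
    (s := {i}) (t := Finset.univ) (by simp; omega)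
  obtain ⟨k, hk⟩ := Finset.exists_mem_notMem_of_card_lt_card
    (s := {i, j}) (t := Finset.univ) (Finset.card_le_two.trans_lt (by simp; omega))
  simp only [Finset.mem_univ, Finset.mem_singleton, Finset.mem_insert, not_or, true_and] at hj hk
  rcases hpair i j (Ne.symm hj) with h1 | h1
  · exact h1
  · rcases hpair i k (Ne.symm hk.1) with h2 | h2
    · exact h2
    · exact absurd (e'.injective (h2.symm.trans h1)) hk.2

end Kneser

section Petersen

/-- The Petersen graph, as a Kneser graph. -/
abbrev petersen : SimpleGraph {s : Finset (Fin 5) // s.card = 2} := kneser (Fin 5) 2 two_ne_zero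

theorem petersen_ncard_neighborSet (v : {s : Finset (Fin 5) // s.card = 2}) :
    (petersen.neighborSet v).ncard = 3 := by
  rw [Set.ncard_eq_toFinset_card']
  revert v
  decide

theorem petersen_connected : petersen.Connected := by
  have h : ∀ v w, v = w ∨ petersen.Adj v w ∨ ∃ u, petersen.Adj v u ∧ petersen.Adj u w := by
    decide
  refine (connected_iff _).2 ⟨fun v w => ?_, ⟨⟨{0, 1}, rfl⟩⟩⟩
  rcases h v w with rfl | h | ⟨u, h1, h2⟩
  · rfl
  · exact h.reachable
  · exact h1.reachable.trans h2.reachable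

theorem card_vertices_petersen : Fintype.card {s : Finset (Fin 5) // s.card = 2} = 10 := by
  rw [Fintype.card_finset_len]
  rfl

theorem card_aut_petersen : Nat.card (petersen ≃g petersen) = 120 := by
  refine le_antisymm (petersen_connected.card_aut_le card_vertices_petersen
    petersen_ncard_neighborSet) ?_
  have := finite_aut petersen
  have h := Nat.card_le_card_of_injective _ (kneserAut_two_injective (n := 5) (by norm_num))
  rwa [Nat.card_perm, Nat.card_eq_fintype_card, Fintype.card_fin] at h

end Petersen

end SimpleGraph

theorem cubic_ten_vertices_aut_bound :
    (∀ (V : Type) [Fintype V], Fintype.card V = 10 →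
      ∀ G : SimpleGraph V, G.Connected → (∀ v : V, (G.neighborSet v).ncard = 3) →
        Nat.card (G ≃g G) ≤ 120) ∧
    (∃ G : SimpleGraph (Fin 10), G.Connected ∧
      (∀ v : Fin 10, (G.neighborSet v).ncard = 3) ∧
      Nat.card (G ≃g G) = 120) := by
  refine ⟨fun V _ hV G hc h3 => hc.card_aut_le hV h3, ?_⟩
  let e : Fin 10 ≃ {s : Finset (Fin 5) // s.card = 2} :=
    (Fintype.equivFinOfCardEq SimpleGraph.card_vertices_petersen).symm
  let φ : SimpleGraph.petersen.comap e ≃g SimpleGraph.petersen := SimpleGraph.Iso.comap e _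
  refine ⟨SimpleGraph.petersen.comap e, φ.connected_iff.2 SimpleGraph.petersen_connected,
    fun v => ?_, ?_⟩
  · rw [← SimpleGraph.petersen_ncard_neighborSet (φ v), ← Nat.card_coe_set_eq,
      ← Nat.card_coe_set_eq]
    exact Nat.card_congr (φ.mapNeighborSet v)
  · rw [← SimpleGraph.card_aut_petersen]
    exact Nat.card_congr
      ⟨fun σ => (φ.symm.trans σ).trans φ, fun σ => (φ.trans σ).trans φ.symm,
        fun σ => by ext; simp, fun σ => by ext; simp⟩
end

section
/- For every natural number n of the form n = 3·2^m with m ≥ 0, there exists a finite tree in which every vertex has degree 1 or 3 and which has exactly n leaves, whose automorphism group has order exactly 3·2^{k(n)}. -/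
/-- `kFun n = n - binOnes n`. -/
def kFun (n : ℕ) : ℕ := n - binOnes n

/-- The graph obtained from `ι` disjoint copies of the graph `G` by adding one new vertex `none`,
adjacent to the copy of the vertex `r` in each of them. -/
def graft {W : Type} (ι : Type) (G : SimpleGraph W) (r : W) : SimpleGraph (Option (ι × W)) where
  Adj
    | none, none => False
    | none, some x => x.2 = r
    | some x, none => x.2 = r
    | some x, some y => x.1 = y.1 ∧ G.Adj x.2 y.2
  symm := ⟨by
    rintro (_ | x) (_ | y) h
    · exact h
    · exact h
    · exact h
    · exact ⟨h.1.symm, h.2.symm⟩⟩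
  loopless := ⟨by
    rintro (_ | x) h
    · exact h
    · exact G.loopless.irrefl _ h.2⟩

section graft

variable {W ι : Type} {G : SimpleGraph W} {r : W}

@[simp] lemma graft_adj_none_none : ¬ (graft ι G r).Adj none none := fun h => h

@[simp] lemma graft_adj_none_some {x : ι × W} :
    (graft ι G r).Adj none (some x) ↔ x.2 = r := Iff.rfl

@[simp] lemma graft_adj_some_none {x : ι × W} :
    (graft ι G r).Adj (some x) none ↔ x.2 = r := Iff.rfl

@[simp] lemma graft_adj_some_some {x y : ι × W} :
    (graft ι G r).Adj (some x) (some y) ↔ x.1 = y.1 ∧ G.Adj x.2 y.2 := Iff.rfl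

/-- The inclusion of the copy of `G` with index `i`. -/
def graftHom (G : SimpleGraph W) (r : W) (i : ι) : G →g graft ι G r where
  toFun w := some (i, w)
  map_rel' h := ⟨rfl, h⟩

lemma exists_walk_graft {m : ℕ} (h : ∀ x, ∃ p : G.Walk r x, p.length ≤ m)
    (x : Option (ι × W)) : ∃ p : (graft ι G r).Walk none x, p.length ≤ m + 1 := by
  rcases x with _ | ⟨i, w⟩
  · exact ⟨.nil, by simp⟩
  · obtain ⟨p, hp⟩ := h w
    have hadj : (graft ι G r).Adj none (graftHom G r i r) := rfl
    change ∃ q : (graft ι G r).Walk none (graftHom G r i w), q.length ≤ m + 1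
    refine ⟨.cons hadj (p.map (graftHom G r i)), ?_⟩
    rwa [SimpleGraph.Walk.length_cons, SimpleGraph.Walk.length_map, add_le_add_iff_right]

lemma connected_graft (hG : G.Connected) : (graft ι G r).Connected := by
  have h (x : Option (ι × W)) : (graft ι G r).Reachable none x := by
    rcases x with _ | ⟨i, w⟩
    · exact .refl _
    · have hadj : (graft ι G r).Adj none (graftHom G r i r) := rfl
      exact hadj.reachable.trans ((hG.preconnected r w).map (graftHom G r i))
  exact { preconnected := fun x y => (h x).symm.trans (h y), nonempty := ⟨none⟩ }

open Classical in
/-- The degree of `v` once a further edge has been attached to `r`. -/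
noncomputable def plantedDegree (G : SimpleGraph W) (r v : W) : ℕ :=
  (G.neighborSet v).ncard + if v = r then 1 else 0

lemma ncard_neighborSet_graft_none : ((graft ι G r).neighborSet none).ncard = Nat.card ι := by
  have : (graft ι G r).neighborSet none = Set.range fun i : ι => some (i, r) := by
    ext (_ | ⟨i, w⟩)
    · simp
    · simp [eq_comm]
  rw [this, ← Set.image_univ, Set.ncard_image_of_injective _ (fun i j h => by simpa using h),
    Set.ncard_univ]

lemma ncard_neighborSet_graft_some [Finite W] (i : ι) (w : W) :
    ((graft ι G r).neighborSet (some (i, w))).ncard = plantedDegree G r w := by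
  have hinj : Function.Injective fun x : W => some (i, x) := fun x y h => by simpa using h
  unfold plantedDegree
  rw [← Set.ncard_image_of_injective (G.neighborSet w) hinj]
  split_ifs with hw
  · rw [← Set.ncard_insert_of_notMem (a := none) (by simp) (Set.toFinite _)]
    congr 1
    ext (_ | ⟨j, x⟩)
    · simp [hw]
    · simp only [SimpleGraph.mem_neighborSet, graft_adj_some_some, Set.mem_insert_iff,
        reduceCtorEq, Set.mem_image, Option.some.injEq, Prod.mk.injEq, false_or]
      grind
  · rw [add_zero]
    congr 1
    ext (_ | ⟨j, x⟩)
    · simp [hw]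
    · simp only [SimpleGraph.mem_neighborSet, graft_adj_some_some,
        Set.mem_image, Option.some.injEq, Prod.mk.injEq]
      grind

lemma plantedDegree_graft_none : plantedDegree (graft ι G r) none none = Nat.card ι + 1 := by
  simp [plantedDegree, ncard_neighborSet_graft_none]

lemma plantedDegree_graft_some [Finite W] (i : ι) (w : W) :
    plantedDegree (graft ι G r) none (some (i, w)) = plantedDegree G r w := by
  simp [plantedDegree, ncard_neighborSet_graft_some]

lemma sum_plantedDegree [Fintype W] :
    ∑ v, plantedDegree G r v = ∑ v, (G.neighborSet v).ncard + 1 := by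
  classical
  simp [plantedDegree, Finset.sum_add_distrib]

lemma sum_ncard_neighborSet_graft [Fintype W] [Fintype ι]
    (h : ∑ v, (G.neighborSet v).ncard + 2 = 2 * Fintype.card W) :
    ∑ v, ((graft ι G r).neighborSet v).ncard + 2 = 2 * Fintype.card (Option (ι × W)) := by
  have h' : ∑ v, plantedDegree G r v + 1 = 2 * Fintype.card W := by rw [sum_plantedDegree, ← h]
  simp only [Fintype.sum_option, Fintype.sum_prod_type, ncard_neighborSet_graft_none,
    ncard_neighborSet_graft_some, Finset.sum_const, Finset.card_univ, smul_eq_mul,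
    Fintype.card_option, Fintype.card_prod, Nat.card_eq_fintype_card]
  linear_combination Fintype.card ι * h'

lemma ncard_setOf_option_prod [Finite W] [Finite ι] (P : Option (ι × W) → Prop) (Q : W → Prop)
    (h : ¬ P none) (hPQ : ∀ i w, P (some (i, w)) ↔ Q w) :
    {v | P v}.ncard = Nat.card ι * {w | Q w}.ncard := by
  have : {v | P v} = some '' ((Set.univ : Set ι) ×ˢ {w | Q w}) := by
    ext (_ | ⟨i, w⟩)
    · simp [h]
    · simp [hPQ]
  rw [this, Set.ncard_image_of_injective _ (Option.some_injective _), Set.ncard_prod,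
    Set.ncard_univ]

/-- An automorphism of the grafted graph assembled from a permutation of the copies and
root-preserving automorphisms of the copies. -/
def graftIso (σ : Equiv.Perm ι) (ψ : ι → {φ : G ≃g G // φ r = r}) :
    graft ι G r ≃g graft ι G r where
  toFun := Option.map fun x => (σ x.1, (ψ x.1).1 x.2)
  invFun := Option.map fun x => (σ.symm x.1, (ψ (σ.symm x.1)).1.symm x.2)
  left_inv := by rintro (_ | ⟨i, w⟩) <;> simp
  right_inv := by rintro (_ | ⟨i, w⟩) <;> simp
  map_rel_iff' := by
    have h (i : ι) (w : W) : (ψ i).1 w = r ↔ w = r :=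
      ⟨fun hw => (ψ i).1.injective (hw.trans (ψ i).2.symm), fun hw => hw ▸ (ψ i).2⟩
    rintro (_ | ⟨i, w⟩) (_ | ⟨j, x⟩)
    · simp
    · simp [h]
    · simp [h]
    · simp only [Equiv.coe_fn_mk, Option.map_some, graft_adj_some_some,
        EmbeddingLike.apply_eq_iff_eq]
      refine and_congr_right fun hij => ?_
      subst hij
      exact (ψ i).1.map_adj_iff

lemma exists_apply_some_eq (hG : G.Connected) (φ : graft ι G r ≃g graft ι G r)
    (hφ : φ none = none) :
    ∃ (σ : ι → ι) (f : ι → W → W), (∀ i w, φ (some (i, w)) = some (σ i, f i w)) ∧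
      ∀ i, f i r = r := by
  have hroot (i : ι) : ∃ j, φ (some (i, r)) = some (j, r) := by
    have h : (graft ι G r).Adj (φ none) (φ (some (i, r))) := φ.map_adj_iff.2 rfl
    rw [hφ] at h
    generalize φ (some (i, r)) = y at h
    rcases y with _ | ⟨j, x⟩
    · exact h.elim
    · exact ⟨j, by rw [show x = r from h]⟩
  choose σ hσ using hroot
  have hwalk (i : ι) {u v : W} (p : G.Walk u v) (hu : ∃ x, φ (some (i, u)) = some (σ i, x)) :
      ∃ x, φ (some (i, v)) = some (σ i, x) := by
    induction p with
    | nil => exact hu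
    | @cons u v w huv p ih =>
      refine ih ?_
      obtain ⟨x, hx⟩ := hu
      have h : (graft ι G r).Adj (φ (some (i, u))) (φ (some (i, v))) :=
        φ.map_adj_iff.2 ⟨rfl, huv⟩
      have hne : φ (some (i, v)) ≠ none := by
        rw [← hφ]
        simp
      rw [hx] at h
      generalize φ (some (i, v)) = y at h hne
      rcases y with _ | ⟨j, y⟩
      · exact (hne rfl).elim
      · exact ⟨y, by rw [show σ i = j from h.1]⟩
  have hbranch (i : ι) (w : W) : ∃ x, φ (some (i, w)) = some (σ i, x) :=
    (hG.preconnected r w).elim fun p => hwalk i p ⟨r, hσ i⟩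
  choose f hf using hbranch
  refine ⟨σ, f, hf, fun i => ?_⟩
  have := (hf i r).symm.trans (hσ i)
  simpa using this

lemma exists_graftIso_eq (hG : G.Connected) (φ : graft ι G r ≃g graft ι G r)
    (hφ : φ none = none) : ∃ σ ψ, graftIso σ ψ = φ := by
  have hφ' : φ.symm none = none := by rw [RelIso.symm_apply_eq, hφ]
  obtain ⟨σ, f, hf, hfr⟩ := exists_apply_some_eq hG φ hφ
  obtain ⟨τ, g, hg, -⟩ := exists_apply_some_eq hG φ.symm hφ'
  have hl (i : ι) (w : W) : τ (σ i) = i ∧ g (σ i) (f i w) = w := by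
    have := φ.symm_apply_apply (some (i, w))
    rw [hf, hg] at this
    simpa using this
  have hr (i : ι) (w : W) : σ (τ i) = i ∧ f (τ i) (g i w) = w := by
    have := φ.apply_symm_apply (some (i, w))
    rw [hg, hf] at this
    simpa using this
  refine ⟨⟨σ, τ, fun i => (hl i r).1, fun i => (hr i r).1⟩,
    fun i => ⟨⟨⟨f i, g (σ i), fun w => (hl i w).2, fun w => ?_⟩, ?_⟩, hfr i⟩, ?_⟩
  · have := (hr (σ i) w).2
    rwa [(hl i r).1] at this
  · intro u v
    have : (graft ι G r).Adj (φ (some (i, u))) (φ (some (i, v))) ↔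
      (graft ι G r).Adj (some (i, u)) (some (i, v)) := φ.map_adj_iff
    simpa [hf] using this
  · ext1 x
    rcases x with _ | ⟨i, w⟩
    · exact hφ.symm
    · exact (hf i w).symm

lemma card_stabilizer_graft [Finite ι] (hG : G.Connected) :
    Nat.card {φ : graft ι G r ≃g graft ι G r // φ none = none} =
      (Nat.card ι).factorial * Nat.card {φ : G ≃g G // φ r = r} ^ Nat.card ι := by
  rw [← Nat.card_perm, ← Nat.card_fun, ← Nat.card_prod]
  symm
  refine Nat.card_eq_of_bijective
    (fun x : Equiv.Perm ι × (ι → {φ : G ≃g G // φ r = r}) =>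
      (⟨graftIso x.1 x.2, rfl⟩ : {φ : graft ι G r ≃g graft ι G r // φ none = none})) ⟨?_, ?_⟩
  · rintro ⟨σ, ψ⟩ ⟨τ, χ⟩ h
    have h' (i : ι) (w : W) : some (σ i, (ψ i).1 w) = some (τ i, (χ i).1 w) :=
      DFunLike.congr_fun (Subtype.ext_iff.1 h) (some (i, w))
    simp only [Option.some.injEq, Prod.mk.injEq] at h'
    refine Prod.ext (Equiv.ext fun i => (h' i r).1) ?_
    funext i
    exact Subtype.ext (RelIso.ext fun w => (h' i w).2)
  · rintro ⟨φ, hφ⟩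
    obtain ⟨σ, ψ, h⟩ := exists_graftIso_eq hG φ hφ
    exact ⟨(σ, ψ), Subtype.ext h⟩

end graft

lemma SimpleGraph.Walk.apply_le_add_length {V : Type} {G : SimpleGraph V} (f : V → ℤ)
    (hf : ∀ a b, G.Adj a b → f b ≤ f a + 1) {u v : V} (p : G.Walk u v) :
    f v ≤ f u + p.length := by
  induction p with
  | nil => simp
  | cons h p ih =>
    have := hf _ _ h
    rw [length_cons]
    push_cast
    linarith

lemma isTree_of_sum_ncard_neighborSet {V : Type} [Fintype V] {G : SimpleGraph V}
    (hG : G.Connected) (h : ∑ v, (G.neighborSet v).ncard + 2 = 2 * Fintype.card V) :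
    G.IsTree := by
  classical
  rw [SimpleGraph.isTree_iff_connected_and_card]
  refine ⟨hG, ?_⟩
  have hdeg (v : V) : (G.neighborSet v).ncard = G.degree v := by
    rw [← Nat.card_coe_set_eq, Nat.card_eq_fintype_card, SimpleGraph.card_neighborSet_eq_degree]
  simp only [hdeg, SimpleGraph.sum_degrees_eq_twice_card_edges] at h
  rw [Nat.card_eq_fintype_card, Nat.card_eq_fintype_card, ← SimpleGraph.edgeFinset_card]
  omega

/-- The properties of the perfect binary tree `G` of height `m` with root `r` that are used to
count its automorphisms and those of three copies of it joined at a new vertex. -/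
structure IsPerfectBinary {W : Type} [Fintype W] (G : SimpleGraph W) (r : W) (m : ℕ) : Prop where
  connected : G.Connected
  sum_degree : ∑ v, (G.neighborSet v).ncard + 2 = 2 * Fintype.card W
  plantedDegree_eq : ∀ v, plantedDegree G r v = 1 ∨ plantedDegree G r v = 3
  card_leaves : {v | plantedDegree G r v = 1}.ncard = 2 ^ m
  card_stabilizer : Nat.card {φ : G ≃g G // φ r = r} = 2 ^ (2 ^ m - 1)
  exists_walk : ∀ x, ∃ p : G.Walk r x, p.length ≤ m
  exists_depth : ∃ d : W → ℕ, d r = 0 ∧ (∀ a b, G.Adj a b → d b ≤ d a + 1) ∧ ∃ x, d x = m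

lemma isPerfectBinary_zero : IsPerfectBinary (⊥ : SimpleGraph Unit) () 0 where
  connected := { preconnected := fun _ _ => .refl _, nonempty := ⟨()⟩ }
  sum_degree := by simp [SimpleGraph.neighborSet]
  plantedDegree_eq _ := by simp [plantedDegree, SimpleGraph.neighborSet]
  card_leaves := by simp [plantedDegree, SimpleGraph.neighborSet]
  card_stabilizer := by
    have : Unique {φ : (⊥ : SimpleGraph Unit) ≃g (⊥ : SimpleGraph Unit) // φ () = ()} :=
      { default := ⟨RelIso.refl _, rfl⟩
        uniq := fun _ => Subtype.ext (RelIso.ext fun _ => rfl) }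
    rw [Nat.card_unique, pow_zero, Nat.sub_self, pow_zero]
  exists_walk _ := ⟨.nil, le_rfl⟩
  exists_depth := ⟨fun _ => 0, rfl, fun _ _ _ => by simp, (), rfl⟩

namespace IsPerfectBinary

variable {W : Type} [Fintype W] {G : SimpleGraph W} {r : W} {m : ℕ}

lemma succ (h : IsPerfectBinary G r m) : IsPerfectBinary (graft Bool G r) none (m + 1) where
  connected := connected_graft h.connected
  sum_degree := sum_ncard_neighborSet_graft h.sum_degree
  plantedDegree_eq := by
    rintro (_ | ⟨i, w⟩)
    · simp [plantedDegree_graft_none]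
    · rw [plantedDegree_graft_some]
      exact h.plantedDegree_eq w
  card_leaves := by
    rw [ncard_setOf_option_prod _ (fun w => plantedDegree G r w = 1)
      (by simp [plantedDegree_graft_none]) (fun i w => by rw [plantedDegree_graft_some]),
      h.card_leaves]
    simp [pow_succ, mul_comm]
  card_stabilizer := by
    rw [card_stabilizer_graft h.connected, h.card_stabilizer]
    have := Nat.one_le_two_pow (n := m)
    rw [Nat.card_eq_fintype_card, Fintype.card_bool, Nat.factorial_two, ← pow_mul, ← pow_succ']
    congr 1
    rw [pow_succ]
    omega
  exists_walk := exists_walk_graft h.exists_walk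
  exists_depth := by
    obtain ⟨d, hr, hd, x, hx⟩ := h.exists_depth
    refine ⟨fun y => y.elim 0 fun z => d z.2 + 1, rfl, ?_, some (true, x), by simp [hx]⟩
    rintro (_ | ⟨i, w⟩) (_ | ⟨j, z⟩) hadj
    · simp
    · simp [show z = r from hadj, hr]
    · simp
    · simpa using hd _ _ hadj.2

lemma graft_apply_none (h : IsPerfectBinary G r m) {ι : Type} [Nontrivial ι]
    (φ : graft ι G r ≃g graft ι G r) : φ none = none := by
  classical
  obtain ⟨d, hr, hd, x, hx⟩ := h.exists_depth
  by_contra hne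
  obtain ⟨⟨i, w⟩, hiw⟩ := Option.ne_none_iff_exists'.1 hne
  obtain ⟨j, hj⟩ := exists_ne i
  obtain ⟨p, hp⟩ := exists_walk_graft (ι := ι) h.exists_walk (φ.symm (some (j, x)))
  let f : Option (ι × W) → ℤ := fun y =>
    y.elim 0 fun z => if z.1 = i then -(d z.2 + 1 : ℤ) else d z.2 + 1
  have hf (a b : Option (ι × W)) (hab : (graft ι G r).Adj a b) : f b ≤ f a + 1 := by
    rcases a with _ | ⟨k, y⟩ <;> rcases b with _ | ⟨l, z⟩
    · simp
    · simp only [show z = r from hab, hr, f, Option.elim]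
      split_ifs <;> simp
    · simp only [show y = r from hab, hr, f, Option.elim]
      split_ifs <;> simp
    · obtain ⟨rfl, hyz⟩ : k = l ∧ G.Adj y z := hab
      have h₁ := hd _ _ hyz
      have h₂ := hd _ _ hyz.symm
      simp only [f, Option.elim]
      split_ifs <;> omega
  have hlen := (p.map φ.toHom).apply_le_add_length f hf
  have hstart : φ.toHom none = some (i, w) := hiw
  have hend : φ.toHom (φ.symm (some (j, x))) = some (j, x) := φ.apply_symm_apply _
  rw [SimpleGraph.Walk.length_map, hstart, hend] at hlen
  simp only [f, Option.elim, hj, if_true, if_false, hx] at hlen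
  omega

end IsPerfectBinary

lemma exists_isPerfectBinary (m : ℕ) :
    ∃ (W : Type) (_ : Fintype W) (G : SimpleGraph W) (r : W), IsPerfectBinary G r m := by
  induction m with
  | zero => exact ⟨Unit, inferInstance, ⊥, (), isPerfectBinary_zero⟩
  | succ m ih =>
    obtain ⟨W, _, G, r, h⟩ := ih
    exact ⟨_, inferInstance, _, _, h.succ⟩

lemma binOnes_three_mul_two_pow (m : ℕ) : binOnes (3 * 2 ^ m) = 2 := by
  rw [binOnes, mul_comm, Nat.digits_base_pow_mul (by norm_num) (by norm_num)]
  simp [List.count_replicate]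

theorem exists_tree_aut_card_exceptional (n m : ℕ) (hn : n = 3 * 2 ^ m) :
    ∃ (V : Type) (_ : Fintype V) (G : SimpleGraph V),
      G.IsTree ∧
      (∀ v : V, (G.neighborSet v).ncard = 1 ∨ (G.neighborSet v).ncard = 3) ∧
      {v : V | (G.neighborSet v).ncard = 1}.ncard = n ∧
      Nat.card (G ≃g G) = 3 * 2 ^ kFun n := by
  obtain ⟨W, _, G, r, h⟩ := exists_isPerfectBinary m
  refine ⟨Option (Fin 3 × W), inferInstance, graft (Fin 3) G r,
    isTree_of_sum_ncard_neighborSet (connected_graft h.connected)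
      (sum_ncard_neighborSet_graft h.sum_degree), ?_, ?_, ?_⟩
  · rintro (_ | ⟨i, w⟩)
    · simp [ncard_neighborSet_graft_none]
    · rw [ncard_neighborSet_graft_some]
      exact h.plantedDegree_eq w
  · rw [ncard_setOf_option_prod _ (fun w => plantedDegree G r w = 1)
      (by simp [ncard_neighborSet_graft_none]) (fun i w => by rw [ncard_neighborSet_graft_some]),
      h.card_leaves, hn]
    simp
  · rw [← Nat.card_congr (Equiv.subtypeUnivEquiv h.graft_apply_none),
      card_stabilizer_graft h.connected, h.card_stabilizer, hn, kFun, binOnes_three_mul_two_pow,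
      Nat.card_eq_fintype_card, Fintype.card_fin, ← pow_mul, show Nat.factorial 3 = 3 * 2 from rfl,
      mul_assoc, ← pow_succ']
    congr 2
    have := Nat.one_le_two_pow (n := m)
    omega
end

section
/- Let d be an even natural number with b(d) = 2 and b(3d) = 4. Then d = 2^m + 2^p for some natural numbers m, p with m > p + 1 ≥ 2 (i.e., p ≥ 1 and m ≥ p + 2). -/
theorem binOnes_two_pow_mul (k n : ℕ) : binOnes (2 ^ k * n) = binOnes n := by
  induction k with
  | zero => simp
  | succ k ih => rw [pow_succ', mul_assoc, binOnes_two_mul, ih]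

theorem exists_eq_two_pow_mul_of_binOnes_eq_succ {n k : ℕ} (h : binOnes n = k + 1) :
    ∃ p r : ℕ, n = 2 ^ p * (2 * r + 1) ∧ binOnes r = k := by
  have hn : n ≠ 0 := by
    rintro rfl
    simp [binOnes] at h
  obtain ⟨p, m, ⟨r, rfl⟩, rfl⟩ := Nat.exists_eq_two_pow_mul_odd hn
  rw [binOnes_two_pow_mul, binOnes_two_mul_add_one] at h
  exact ⟨p, r, rfl, by omega⟩

theorem eq_zero_of_binOnes_eq_zero {n : ℕ} (h : binOnes n = 0) : n = 0 := by
  by_contra hn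
  obtain ⟨p, m, ⟨r, rfl⟩, rfl⟩ := Nat.exists_eq_two_pow_mul_odd hn
  rw [binOnes_two_pow_mul, binOnes_two_mul_add_one] at h
  omega

theorem exists_eq_two_pow_of_binOnes_eq_one {n : ℕ} (h : binOnes n = 1) :
    ∃ p : ℕ, n = 2 ^ p := by
  obtain ⟨p, r, rfl, hr⟩ := exists_eq_two_pow_mul_of_binOnes_eq_succ h
  exact ⟨p, by rw [eq_zero_of_binOnes_eq_zero hr]; simp⟩

theorem even_two_ones (d : ℕ) (heven : Even d) (hb : binOnes d = 2)
    (hb3 : binOnes (3 * d) = 4) :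
    ∃ m p : ℕ, 1 ≤ p ∧ p + 2 ≤ m ∧ d = 2 ^ m + 2 ^ p := by
  obtain ⟨p, r, rfl, hr⟩ := exists_eq_two_pow_mul_of_binOnes_eq_succ hb
  obtain ⟨q, rfl⟩ := exists_eq_two_pow_of_binOnes_eq_one hr
  refine ⟨p + q + 1, p, ?_, ?_, by ring⟩
  · by_contra hp
    obtain rfl : p = 0 := by omega
    simp [parity_simps] at heven
  · by_contra hq
    obtain rfl : q = 0 := by omega
    rw [mul_left_comm, binOnes_two_pow_mul] at hb3
    norm_num [binOnes] at hb3
end
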